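/- arXiv:1506.01619 — 2 statements merged into one kernel-verified Lean document; each statement's English description precedes it below -/
import Mathlib

section
/- For each k ∈ (0, k_max) there exists a unique b ∈ (m, b₀) with F(b) = k, and then V(k) = b. Moreover, the infimum defining V(k) is attained by some density if and only if the infimum defining F(b) is attained (for this b), and in that case the same density attains both infima. -/
open MeasureTheory Filter Set Topology
open scoped ENNReal

noncomputable section

variable {Ω : Type*} [MeasurableSpace Ω]

/-- The positive part of an extended real number, as a member of `ℝ≥0∞`. -/
def ePos (x : EReal) : ℝ≥0∞ := if x = ⊤ then ⊤ else ENNReal.ofReal x.toReal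

/-- The (signed) integral of an extended-real-valued function: the integral of its
positive part minus the integral of its negative part. -/
def eInt (μ : Measure Ω) (f : Ω → EReal) : EReal :=
  ((∫⁻ r, ePos (f r) ∂μ : ℝ≥0∞) : EReal) - ((∫⁻ r, ePos (-(f r)) ∂μ : ℝ≥0∞) : EReal)

/-- `p` is a probability density with respect to `μ`. -/
def IsDensity (μ : Measure Ω) (p : Ω → ℝ) : Prop :=
  Measurable p ∧ (∀ r, 0 ≤ p r) ∧ ∫⁻ r, ENNReal.ofReal (p r) ∂μ = 1

/-- `∫ p dμ` for a nonnegative function `p`. -/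
def pInt (μ : Measure Ω) (p : Ω → ℝ) : ℝ≥0∞ := ∫⁻ r, ENNReal.ofReal (p r) ∂μ

/-- The convex integral functional `H(p) = ∫ β(r, p(r)) μ(dr)`. -/
def Hfun (μ : Measure Ω) (β : Ω → ℝ → EReal) (p : Ω → ℝ) : EReal :=
  eInt μ (fun r => β r (p r))

/-- The expected payoff `∫ X p dμ`, as an extended real number. -/
def xInt (μ : Measure Ω) (X p : Ω → ℝ) : EReal :=
  eInt μ (fun r => ((X r * p r : ℝ) : EReal))

/-- The value function `F(b) = inf { H(p) : p density, ∫ X p dμ = b }`. -/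
def Ffun (μ : Measure Ω) (β : Ω → ℝ → EReal) (X : Ω → ℝ) (b : ℝ) : EReal :=
  ⨅ p : {p : Ω → ℝ // IsDensity μ p ∧ xInt μ X p = (b : EReal)}, Hfun μ β p.1

/-- The essential infimum `m` of `X`, as an extended real number. -/
def essInfX (μ : Measure Ω) (X : Ω → ℝ) : EReal := essInf (fun r => (X r : EReal)) μ

/-- The essential supremum `M` of `X`, as an extended real number. -/
def essSupX (μ : Measure Ω) (X : Ω → ℝ) : EReal := essSup (fun r => (X r : EReal)) μ

/-- `k_max = lim_{b ↓ m} F(b)`; since `F` is nonincreasing on `(m, b₀)`, this limit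
equals the supremum of `F` over `(m, b₀)`. -/
def kmax (μ : Measure Ω) (β : Ω → ℝ → EReal) (X : Ω → ℝ) (b₀ : ℝ) : EReal :=
  ⨆ b : {b : ℝ // essInfX μ X < (b : EReal) ∧ b < b₀}, Ffun μ β X b

/-- `V(k) = inf { ∫ X p dμ : p density, H(p) ≤ k }`. -/
def Vfun (μ : Measure Ω) (β : Ω → ℝ → EReal) (X : Ω → ℝ) (k : ℝ) : EReal :=
  ⨅ p : {p : Ω → ℝ // IsDensity μ p ∧ Hfun μ β p ≤ (k : EReal)}, xInt μ X p.1

/-- `W(λ) = inf { ∫ X p dμ + λ H(p) : p density }`. -/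
def Wfun (μ : Measure Ω) (β : Ω → ℝ → EReal) (X : Ω → ℝ) (lam : ℝ) : EReal :=
  ⨅ p : {p : Ω → ℝ // IsDensity μ p}, (xInt μ X p.1 + (lam : EReal) * Hfun μ β p.1)

/-- The convex conjugate `β*(r, τ) = sup_s (sτ − β(r,s))` of `β` in its second variable. -/
def conjβ (β : Ω → ℝ → EReal) (r : Ω) (τ : ℝ) : EReal :=
  ⨆ s : ℝ, (((s * τ : ℝ) : EReal) - β r s)

/-- `K(θ₁, θ₂) = ∫ β*(r, θ₁ + θ₂ X(r)) μ(dr)`. -/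
def Kfun (μ : Measure Ω) (β : Ω → ℝ → EReal) (X : Ω → ℝ) (θ₁ θ₂ : ℝ) : EReal :=
  eInt μ (fun r => conjβ β r (θ₁ + θ₂ * X r))

/-- `dom K = {(θ₁, θ₂) : K(θ₁,θ₂) < +∞}`. -/
def domK (μ : Measure Ω) (β : Ω → ℝ → EReal) (X : Ω → ℝ) : Set (ℝ × ℝ) :=
  {θ : ℝ × ℝ | Kfun μ β X θ.1 θ.2 < ⊤}

/-- `β'(r, +∞) = lim_{s ↑ ∞} β'(r,s)`; by monotonicity of the derivative of a convex
function this equals the supremum of `β'(r, ·)` over `(0, ∞)`. -/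
def derivTop (β' : Ω → ℝ → ℝ) (r : Ω) : EReal := ⨆ s : {s : ℝ // 0 < s}, (β' r s.1 : EReal)

/-- `β'(r, 0) = lim_{s ↓ 0} β'(r,s)`, the infimum of `β'(r, ·)` over `(0, ∞)`. -/
def derivZero (β' : Ω → ℝ → ℝ) (r : Ω) : EReal := ⨅ s : {s : ℝ // 0 < s}, (β' r s.1 : EReal)

/-- The parameter set `Θ`. -/
def ThetaSet (μ : Measure Ω) (β : Ω → ℝ → EReal) (β' : Ω → ℝ → ℝ) (X : Ω → ℝ) :
    Set (ℝ × ℝ) :=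
  {θ ∈ domK μ β X | ∀ᵐ r ∂μ, ((θ.1 + θ.2 * X r : ℝ) : EReal) < derivTop β' r}

/-- The generalised exponential family member `p_{θ₁,θ₂}(r) = (β*)'(r, θ₁ + θ₂ X(r))`,
where `ψ` denotes the derivative `(β*)'` of the conjugate in its second variable. -/
def pFam (ψ : Ω → ℝ → ℝ) (X : Ω → ℝ) (θ₁ θ₂ : ℝ) : Ω → ℝ :=
  fun r => ψ r (θ₁ + θ₂ * X r)

/-- `G(θ₂) = inf_{θ₁} [K(θ₁,θ₂) − θ₁]`. -/
def Gfun (μ : Measure Ω) (β : Ω → ℝ → EReal) (X : Ω → ℝ) (θ₂ : ℝ) : EReal :=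
  ⨅ θ₁ : ℝ, (Kfun μ β X θ₁ θ₂ - (θ₁ : EReal))

/-- `Θ₂ = dom G`, the projection of `dom K` to the `θ₂`-axis. -/
def Theta2 (μ : Measure Ω) (β : Ω → ℝ → EReal) (X : Ω → ℝ) : Set ℝ :=
  {θ₂ : ℝ | Gfun μ β X θ₂ < ⊤}

/-- The Bregman integrand `Δ_β(r, s, t)`; for `t = 0` it is defined as the limit `t ↓ 0`
(with `β'(r,0) = lim_{t↓0} β'(r,t)`), and if `β(r,0) = +∞` then `Δ_β(r,0,0) = 0` and
`Δ_β(r,s,0) = +∞` for `s > 0`. -/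
def bregmanInt (β : Ω → ℝ → EReal) (β' : Ω → ℝ → ℝ) (r : Ω) (s t : ℝ) : EReal :=
  if 0 < t then β r s - β r t - ((β' r t : EReal) * ((s - t : ℝ) : EReal))
  else if β r 0 = ⊤ then (if s = 0 then 0 else ⊤)
  else β r s - β r 0 - derivZero β' r * ((s : ℝ) : EReal)

/-- The (generalised) Bregman distance `B(p, q)`. -/
def Bdist (μ : Measure Ω) (β : Ω → ℝ → EReal) (β' : Ω → ℝ → ℝ) (p q : Ω → ℝ) : EReal :=
  eInt μ (fun r => bregmanInt β β' r (p r) (q r))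

/-- The standing assumptions of the framework: `μ` is σ-finite; `β` is a normal convex
integrand (measurable in `r`; equal to `+∞` for `s < 0`; finite, strictly convex and
differentiable with derivative `β'` on `(0,∞)`; right-continuous at `0`); `p₀` is a
density with finite expected payoff `b₀` satisfying `m < b₀ < M`; `H(p₀) = 0 ≤ H(p)`
for every density `p`; and `k_max > 0`. -/
structure Standing (μ : Measure Ω) (β : Ω → ℝ → EReal) (β' : Ω → ℝ → ℝ)
    (X : Ω → ℝ) (p₀ : Ω → ℝ) (b₀ : ℝ) : Prop where
  sigma : SigmaFinite μ
  betaMeas : ∀ s : ℝ, Measurable (fun r => β r s)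
  Xmeas : Measurable X
  betaNeg : ∀ r : Ω, ∀ s : ℝ, s < 0 → β r s = ⊤
  betaNeBot : ∀ r s, β r s ≠ ⊥
  betaFin : ∀ r : Ω, ∀ s : ℝ, 0 < s → β r s ≠ ⊤
  betaZero : ∀ r, Tendsto (fun s => β r s) (𝓝[>] (0:ℝ)) (𝓝 (β r 0))
  betaConv : ∀ r, StrictConvexOn ℝ (Ioi (0:ℝ)) (fun s => (β r s).toReal)
  betaDeriv : ∀ r : Ω, ∀ s ∈ Ioi (0:ℝ), HasDerivAt (fun t => (β r t).toReal) (β' r s) s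
  dens₀ : IsDensity μ p₀
  payoff₀ : xInt μ X p₀ = (b₀ : EReal)
  mlt : essInfX μ X < (b₀ : EReal)
  ltM : (b₀ : EReal) < essSupX μ X
  H₀ : Hfun μ β p₀ = 0
  Hnonneg : ∀ p, IsDensity μ p → 0 ≤ Hfun μ β p
  kmaxPos : 0 < kmax μ β X b₀

/-- The hypothesis that `ψ = (β*)'`: at every point `τ < β'(r,+∞)`, where the conjugate
`β*(r,·)` is finite and differentiable, `ψ r τ` is its derivative. -/
def IsConjDeriv (β : Ω → ℝ → EReal) (β' : Ω → ℝ → ℝ) (ψ : Ω → ℝ → ℝ) : Prop :=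
  ∀ r : Ω, ∀ τ : ℝ, ((τ : ℝ) : EReal) < derivTop β' r →
    HasDerivAt (fun t => (conjβ β r t).toReal) (ψ r τ) τ

/-- `(θ₁, θ₂)` with `θ₂ < 0` attains the double maximum
`max_{θ₂<0} max_{θ₁} (k + K(θ₁,θ₂) − θ₁)/θ₂` (whose value is `V(k)`); such a pair is a
parameter pair of the worst case localiser `q̂_k = p_{θ₁,θ₂}`. -/
def IsWCLParam (μ : Measure Ω) (β : Ω → ℝ → EReal) (X : Ω → ℝ) (k : ℝ) (θ₁ θ₂ : ℝ) : Prop :=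
  θ₂ < 0 ∧ ∀ θ₁' θ₂' : ℝ, θ₂' < 0 →
    ((k : EReal) + Kfun μ β X θ₁' θ₂' - (θ₁' : EReal)) / ((θ₂' : ℝ) : EReal) ≤
      ((k : EReal) + Kfun μ β X θ₁ θ₂ - (θ₁ : EReal)) / ((θ₂ : ℝ) : EReal)

/-- `p` is an (ε-γ)-almost worst case density for threshold `k`. -/
def AWCD (μ : Measure Ω) (β : Ω → ℝ → EReal) (X : Ω → ℝ) (k ε γ : ℝ) (p : Ω → ℝ) : Prop :=
  IsDensity μ p ∧ Hfun μ β p ≤ ((k + γ : ℝ) : EReal) ∧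
    xInt μ X p ≤ Vfun μ β X k + (ε : EReal)

/-- Convergence locally in measure. -/
def TendstoLocallyInMeasure (μ : Measure Ω) (p : ℕ → Ω → ℝ) (q : Ω → ℝ) : Prop :=
  ∀ C : Set Ω, MeasurableSet C → μ C < ⊤ → ∀ ε : ℝ, 0 < ε →
    Tendsto (fun n => μ {r ∈ C | ε < |p n r - q r|}) atTop (𝓝 0)

end

theorem ePos_coe (x : ℝ) : ePos (x : EReal) = ENNReal.ofReal x := by
  simp [ePos]

theorem eInt_congr_ae {Ω : Type*} [MeasurableSpace Ω] {μ : Measure Ω} {f g : Ω → EReal}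
    (h : f =ᵐ[μ] g) : eInt μ f = eInt μ g := by
  unfold eInt
  rw [lintegral_congr_ae (h.mono fun r hr => show ePos (f r) = ePos (g r) by rw [hr]),
    lintegral_congr_ae (h.mono fun r hr => show ePos (-f r) = ePos (-g r) by rw [hr])]

theorem ennreal_sub_ne_bot {a b : ℝ≥0∞} (h : (a : EReal) - (b : EReal) ≠ ⊥) : b ≠ ⊤ := by
  rintro rfl
  simp at h

theorem ennreal_sub_ne_top {a b : ℝ≥0∞} (hb : b ≠ ⊤) (h : (a : EReal) - (b : EReal) ≠ ⊤) :
    a ≠ ⊤ := by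
  rintro rfl
  lift b to NNReal using hb
  exact h (EReal.top_sub_coe (b : ℝ))

theorem eInt_coe_of_integrable {Ω : Type*} [MeasurableSpace Ω] {μ : Measure Ω} {g : Ω → ℝ}
    (hg : Integrable g μ) : eInt μ (fun r => (g r : EReal)) = ((∫ r, g r ∂μ : ℝ) : EReal) := by
  rw [integral_eq_lintegral_pos_part_sub_lintegral_neg_part hg]
  have h1 : ∫⁻ r, ENNReal.ofReal (g r) ∂μ ≠ ⊤ := hg.lintegral_lt_top.ne
  have h2 : ∫⁻ r, ENNReal.ofReal (-g r) ∂μ ≠ ⊤ := hg.neg.lintegral_lt_top.ne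
  simp only [eInt, ← EReal.coe_neg, ePos_coe]
  rw [EReal.coe_sub, EReal.coe_ennreal_toReal h1, EReal.coe_ennreal_toReal h2]

theorem integrable_of_lintegral_parts {Ω : Type*} [MeasurableSpace Ω] {μ : Measure Ω}
    {g : Ω → ℝ} (hm : AEStronglyMeasurable g μ) (h1 : ∫⁻ r, ENNReal.ofReal (g r) ∂μ ≠ ⊤)
    (h2 : ∫⁻ r, ENNReal.ofReal (-g r) ∂μ ≠ ⊤) : Integrable g μ := by
  refine ⟨hm, ?_⟩
  rw [hasFiniteIntegral_iff_norm]
  refine lt_of_le_of_lt (lintegral_mono fun r => ?_)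
    (lt_of_le_of_lt (lintegral_add_left' ?_ _).le (ENNReal.add_lt_top.2 ⟨h1.lt_top, h2.lt_top⟩))
  · rcases le_total 0 (g r) with h | h
    · rw [Real.norm_of_nonneg h]; exact le_self_add
    · rw [Real.norm_of_nonpos h]; exact le_add_self
  · exact hm.aemeasurable.ennreal_ofReal

theorem integrable_of_eInt_coe {Ω : Type*} [MeasurableSpace Ω] {μ : Measure Ω} {g : Ω → ℝ}
    (hm : AEStronglyMeasurable g μ) (hb : eInt μ (fun r => (g r : EReal)) ≠ ⊥)
    (ht : eInt μ (fun r => (g r : EReal)) ≠ ⊤) : Integrable g μ := by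
  simp only [eInt, ← EReal.coe_neg, ePos_coe] at hb ht
  exact integrable_of_lintegral_parts hm
    (ennreal_sub_ne_top (ennreal_sub_ne_bot hb) ht) (ennreal_sub_ne_bot hb)

theorem ae_ne_top_of_eInt {Ω : Type*} [MeasurableSpace Ω] {μ : Measure Ω} {f : Ω → EReal}
    (hm : Measurable f) (hb : eInt μ f ≠ ⊥) (ht : eInt μ f ≠ ⊤) : ∀ᵐ r ∂μ, f r ≠ ⊤ := by
  have h := ennreal_sub_ne_top (ennreal_sub_ne_bot hb) ht
  have hme : Measurable fun r => ePos (f r) := by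
    unfold ePos
    exact Measurable.ite (hm (measurableSet_singleton ⊤)) measurable_const
      hm.ereal_toReal.ennreal_ofReal
  filter_upwards [ae_lt_top hme h] with r hr htop
  simp [htop, ePos] at hr

theorem eInt_eq_of_ae_finite {Ω : Type*} [MeasurableSpace Ω] {μ : Measure Ω} {f : Ω → EReal}
    (hnt : ∀ᵐ r ∂μ, f r ≠ ⊤) (hnb : ∀ r, f r ≠ ⊥) :
    eInt μ f = eInt μ (fun r => (((f r).toReal : ℝ) : EReal)) :=
  eInt_congr_ae (hnt.mono fun r hr => (EReal.coe_toReal hr (hnb r)).symm)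

theorem integrable_toReal_of_eInt_le {Ω : Type*} [MeasurableSpace Ω] {μ : Measure Ω}
    {f : Ω → EReal} (hm : Measurable f) (hnb : ∀ r, f r ≠ ⊥) (h0 : 0 ≤ eInt μ f) {h : ℝ}
    (hle : eInt μ f ≤ (h : EReal)) :
    (∀ᵐ r ∂μ, f r ≠ ⊤) ∧ Integrable (fun r => (f r).toReal) μ ∧ ∫ r, (f r).toReal ∂μ ≤ h := by
  have hb : eInt μ f ≠ ⊥ := (lt_of_lt_of_le (EReal.bot_lt_zero) h0).ne'
  have ht : eInt μ f ≠ ⊤ := (lt_of_le_of_lt hle (EReal.coe_lt_top h)).ne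
  have hae := ae_ne_top_of_eInt hm hb ht
  rw [eInt_eq_of_ae_finite hae hnb] at hb ht hle
  have hi := integrable_of_eInt_coe hm.ereal_toReal.aestronglyMeasurable hb ht
  rw [eInt_coe_of_integrable hi] at hle
  exact ⟨hae, hi, EReal.coe_le_coe_iff.1 hle⟩

/-- An integrable upper bound and a nonnegative signed integral force integrability. -/
theorem eInt_le_integral_of_le {Ω : Type*} [MeasurableSpace Ω] {μ : Measure Ω} {f : Ω → EReal}
    (hm : Measurable f) (hnb : ∀ r, f r ≠ ⊥) (h0 : 0 ≤ eInt μ f) {G : Ω → ℝ}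
    (hG : Integrable G μ) (hle : ∀ᵐ r ∂μ, f r ≤ (G r : EReal)) :
    eInt μ f ≤ ((∫ r, G r ∂μ : ℝ) : EReal) := by
  have hnt : ∀ᵐ r ∂μ, f r ≠ ⊤ :=
    hle.mono fun r hr => (lt_of_le_of_lt hr (EReal.coe_lt_top _)).ne
  have hleR : ∀ᵐ r ∂μ, (f r).toReal ≤ G r := by
    filter_upwards [hle, hnt] with r hr hr'
    rwa [← EReal.coe_toReal hr' (hnb r), EReal.coe_le_coe_iff] at hr
  rw [eInt_eq_of_ae_finite hnt hnb] at h0 ⊢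
  have hb : eInt μ (fun r => (((f r).toReal : ℝ) : EReal)) ≠ ⊥ :=
    (lt_of_lt_of_le (EReal.bot_lt_zero) h0).ne'
  have hi : Integrable (fun r => (f r).toReal) μ := by
    simp only [eInt, ← EReal.coe_neg, ePos_coe] at hb
    refine integrable_of_lintegral_parts hm.ereal_toReal.aestronglyMeasurable ?_
      (ennreal_sub_ne_bot hb)
    exact (lt_of_le_of_lt (lintegral_mono_ae (hleR.mono fun r hr =>
      ENNReal.ofReal_le_ofReal hr)) hG.lintegral_lt_top).ne
  rw [eInt_coe_of_integrable hi, EReal.coe_le_coe_iff]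
  exact integral_mono_ae hi hG hleR

theorem integrable_sub_mul_add_mul {Ω : Type*} [MeasurableSpace Ω] {μ : Measure Ω}
    {f g h : Ω → ℝ} (hf : Integrable f μ) (hg : Integrable g μ) (hh : Integrable h μ) (a b : ℝ) :
    Integrable (fun r => f r - a * g r + b * h r) μ :=
  (hf.sub (hg.const_mul a)).add (hh.const_mul b)

theorem integral_sub_mul_add_mul {Ω : Type*} [MeasurableSpace Ω] {μ : Measure Ω}
    {f g h : Ω → ℝ} (hf : Integrable f μ) (hg : Integrable g μ) (hh : Integrable h μ) (a b : ℝ) :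
    ∫ r, (f r - a * g r + b * h r) ∂μ = ∫ r, f r ∂μ - a * ∫ r, g r ∂μ + b * ∫ r, h r ∂μ := by
  have hfg : Integrable (fun r => f r - a * g r) μ := hf.sub (hg.const_mul a)
  rw [integral_add hfg (hh.const_mul b), integral_sub hf (hg.const_mul a), integral_const_mul,
    integral_const_mul]

section Standing

variable {Ω : Type*} [MeasurableSpace Ω] {μ : Measure Ω} {β : Ω → ℝ → EReal} {β' : Ω → ℝ → ℝ}
  {X : Ω → ℝ} {p₀ : Ω → ℝ} {b₀ : ℝ}

theorem Standing.tendsto_right (hst : Standing μ β β' X p₀ b₀) (r : Ω) {s : ℝ} (hs : 0 ≤ s) :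
    Tendsto (β r) (𝓝[>] s) (𝓝 (β r s)) := by
  rcases hs.eq_or_lt with rfl | hs
  · exact hst.betaZero r
  have hc : Tendsto (fun t => (((β r t).toReal : ℝ) : EReal)) (𝓝 s)
      (𝓝 (((β r s).toReal : ℝ) : EReal)) :=
    (continuous_coe_real_ereal.tendsto _).comp (hst.betaDeriv r s hs).continuousAt
  rw [EReal.coe_toReal (hst.betaFin r s hs) (hst.betaNeBot r s)] at hc
  refine (hc.mono_left nhdsWithin_le_nhds).congr' ?_
  filter_upwards [self_mem_nhdsWithin] with t ht
  exact EReal.coe_toReal (hst.betaFin r t (hs.trans ht)) (hst.betaNeBot r t)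

theorem Standing.convex_ereal (hst : Standing μ β β' X p₀ b₀) (r : Ω) {s t a : ℝ} (hs : 0 ≤ s)
    (ht : 0 ≤ t) (ha0 : 0 ≤ a) (ha1 : a ≤ 1) (hsf : β r s ≠ ⊤) (htf : β r t ≠ ⊤) :
    β r ((1 - a) * s + a * t) ≤ (((1 - a) * (β r s).toReal + a * (β r t).toReal : ℝ) : EReal) := by
  have key : ∀ s : ℝ, 0 ≤ s → Tendsto (fun e => β r (s + e)) (𝓝[>] (0:ℝ)) (𝓝 (β r s)) := by
    intro s hs
    refine (hst.tendsto_right r hs).comp ?_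
    refine tendsto_nhdsWithin_iff.2 ⟨?_, ?_⟩
    · have : Tendsto (fun e : ℝ => s + e) (𝓝 0) (𝓝 (s + 0)) :=
        (continuous_const.add continuous_id).tendsto 0
      rw [add_zero] at this
      exact this.mono_left nhdsWithin_le_nhds
    · filter_upwards [self_mem_nhdsWithin] with e he
      simpa using he
  have keyR : ∀ s : ℝ, 0 ≤ s → β r s ≠ ⊤ →
      Tendsto (fun e => (β r (s + e)).toReal) (𝓝[>] (0:ℝ)) (𝓝 (β r s).toReal) := fun s hs hf =>
    (EReal.tendsto_toReal hf (hst.betaNeBot r s)).comp (key s hs)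
  have hx : 0 ≤ (1 - a) * s + a * t :=
    add_nonneg (mul_nonneg (sub_nonneg.2 ha1) hs) (mul_nonneg ha0 ht)
  refine le_of_tendsto_of_tendsto (key _ hx) ((continuous_coe_real_ereal.tendsto _).comp
    (((keyR s hs hsf).const_mul (1 - a)).add ((keyR t ht htf).const_mul a))) ?_
  filter_upwards [self_mem_nhdsWithin] with e he
  have he' : 0 < e := he
  have h := (hst.betaConv r).convexOn.2 (show s + e ∈ Ioi (0:ℝ) from by
    simp only [mem_Ioi]; linarith) (show t + e ∈ Ioi (0:ℝ) from by
    simp only [mem_Ioi]; linarith) (sub_nonneg.2 ha1) ha0 (by ring)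
  simp only [smul_eq_mul] at h
  rw [show (1 - a) * (s + e) + a * (t + e) = (1 - a) * s + a * t + e by ring] at h
  rw [← EReal.coe_toReal (hst.betaFin r ((1 - a) * s + a * t + e) (by linarith))
    (hst.betaNeBot r _)]
  exact EReal.coe_le_coe_iff.2 h

theorem Standing.measurable_comp (hst : Standing μ β β' X p₀ b₀) {p : Ω → ℝ} (hp : Measurable p)
    (h0 : ∀ r, 0 ≤ p r) : Measurable fun r => β r (p r) := by
  refine measurable_of_tendsto_metrizable
    (f := fun n : ℕ => fun r => β r ((⌊((n:ℝ) + 1) * p r⌋ + 1) / ((n:ℝ) + 1))) ?_ ?_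
  · intro n
    have h1 : Measurable fun x : Ω × ℤ => β x.1 ((x.2 + 1) / ((n:ℝ) + 1)) :=
      measurable_from_prod_countable_left fun k =>
        hst.betaMeas ((k + 1) / ((n:ℝ) + 1))
    exact h1.comp (measurable_id.prodMk (hp.const_mul ((n:ℝ) + 1)).floor)
  · rw [tendsto_pi_nhds]
    intro r
    refine (hst.tendsto_right r (h0 r)).comp (tendsto_nhdsWithin_iff.2 ⟨?_, ?_⟩)
    · refine tendsto_of_tendsto_of_tendsto_of_le_of_le tendsto_const_nhds
        (show Tendsto (fun n : ℕ => p r + 1 / ((n:ℝ) + 1)) atTop (𝓝 (p r)) from by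
          simpa using tendsto_const_nhds.add (tendsto_one_div_add_atTop_nhds_zero_nat (𝕜 := ℝ)))
        ?_ ?_
      · intro n
        have hn : (0:ℝ) < n + 1 := by positivity
        simp only
        rw [le_div_iff₀ hn]
        linarith [Int.lt_floor_add_one (((n:ℝ) + 1) * p r)]
      · intro n
        have hn : (0:ℝ) < n + 1 := by positivity
        simp only
        rw [div_le_iff₀ hn, add_mul (p r), one_div, inv_mul_cancel₀ hn.ne']
        linarith [Int.floor_le (((n:ℝ) + 1) * p r)]
    · refine Eventually.of_forall fun n => ?_
      have hn : (0:ℝ) < n + 1 := by positivity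
      simp only [mem_Ioi]
      rw [lt_div_iff₀ hn]
      linarith [Int.lt_floor_add_one (((n:ℝ) + 1) * p r)]

theorem IsDensity.integrable {p : Ω → ℝ} (hp : IsDensity μ p) : Integrable p μ :=
  integrable_of_lintegral_parts hp.1.aestronglyMeasurable (by rw [hp.2.2]; simp)
    (by simp [ENNReal.ofReal_of_nonpos, hp.2.1])

theorem IsDensity.integral_eq_one {p : Ω → ℝ} (hp : IsDensity μ p) : ∫ r, p r ∂μ = 1 := by
  rw [integral_eq_lintegral_of_nonneg_ae (Eventually.of_forall hp.2.1)
    hp.1.aestronglyMeasurable, hp.2.2]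
  simp

theorem isDensity_of_integral {p : Ω → ℝ} (hm : Measurable p) (h0 : ∀ r, 0 ≤ p r)
    (hi : Integrable p μ) (h1 : ∫ r, p r ∂μ = 1) : IsDensity μ p := by
  refine ⟨hm, h0, ?_⟩
  rw [← ofReal_integral_eq_lintegral_ofReal hi (Eventually.of_forall h0), h1]
  simp

theorem xInt_integrable {p : Ω → ℝ} {x : ℝ} (hX : Measurable X) (hp : IsDensity μ p)
    (h : xInt μ X p = (x : EReal)) :
    Integrable (fun r => X r * p r) μ ∧ ∫ r, X r * p r ∂μ = x := by
  have hi : Integrable (fun r => X r * p r) μ :=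
    integrable_of_eInt_coe (hX.mul hp.1).aestronglyMeasurable
      (by unfold xInt at h; rw [h]; simp) (by unfold xInt at h; rw [h]; simp)
  refine ⟨hi, ?_⟩
  rw [xInt, eInt_coe_of_integrable hi] at h
  exact EReal.coe_eq_coe_iff.1 h

/-- The pair `(x, h)` is attainable: some density has payoff `x` and divergence at most `h`. -/
def Feasible (μ : Measure Ω) (β : Ω → ℝ → EReal) (X : Ω → ℝ) (x h : ℝ) : Prop :=
  ∃ p, IsDensity μ p ∧ xInt μ X p = (x : EReal) ∧ Hfun μ β p ≤ (h : EReal)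

theorem Standing.energy (hst : Standing μ β β' X p₀ b₀) {p : Ω → ℝ} (hp : IsDensity μ p) {h : ℝ}
    (hh : Hfun μ β p ≤ (h : EReal)) :
    (∀ᵐ r ∂μ, β r (p r) ≠ ⊤) ∧ Integrable (fun r => (β r (p r)).toReal) μ ∧
      ∫ r, (β r (p r)).toReal ∂μ ≤ h :=
  integrable_toReal_of_eInt_le (hst.measurable_comp hp.1 hp.2.1) (fun r => hst.betaNeBot r _)
    (hst.Hnonneg p hp) hh

theorem Standing.feasible_of_le (hst : Standing μ β β' X p₀ b₀) {p : Ω → ℝ} (hm : Measurable p)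
    (h0 : ∀ r, 0 ≤ p r) (hi : Integrable p μ) (h1 : ∫ r, p r ∂μ = 1)
    (hX : Integrable (fun r => X r * p r) μ) {G : Ω → ℝ} (hG : Integrable G μ)
    (hle : ∀ᵐ r ∂μ, β r (p r) ≤ (G r : EReal)) :
    Feasible μ β X (∫ r, X r * p r ∂μ) (∫ r, G r ∂μ) := by
  have hp := isDensity_of_integral hm h0 hi h1
  exact ⟨p, hp, eInt_coe_of_integrable hX,
    eInt_le_integral_of_le (hst.measurable_comp hm h0) (fun r => hst.betaNeBot r _)
      (hst.Hnonneg p hp) hG hle⟩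

theorem Feasible.mono {x h h' : ℝ} (hf : Feasible μ β X x h) (hh : h ≤ h') :
    Feasible μ β X x h' := by
  obtain ⟨p, hp, hx, hH⟩ := hf
  exact ⟨p, hp, hx, hH.trans (EReal.coe_le_coe_iff.2 hh)⟩

theorem Feasible.nonneg (hst : Standing μ β β' X p₀ b₀) {x h : ℝ} (hf : Feasible μ β X x h) :
    0 ≤ h := by
  obtain ⟨p, hp, -, hH⟩ := hf
  exact_mod_cast (hst.Hnonneg p hp).trans hH

theorem Standing.feasible_base (hst : Standing μ β β' X p₀ b₀) : Feasible μ β X b₀ 0 :=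
  ⟨p₀, hst.dens₀, hst.payoff₀, by rw [hst.H₀]; simp⟩

theorem Feasible.convex (hst : Standing μ β β' X p₀ b₀) {x y h k a : ℝ}
    (hx : Feasible μ β X x h) (hy : Feasible μ β X y k) (ha0 : 0 ≤ a) (ha1 : a ≤ 1) :
    Feasible μ β X ((1 - a) * x + a * y) ((1 - a) * h + a * k) := by
  obtain ⟨p, hp, hpx, hpH⟩ := hx
  obtain ⟨q, hq, hqx, hqH⟩ := hy
  obtain ⟨hpt, hpi, hpl⟩ := hst.energy hp hpH
  obtain ⟨hqt, hqi, hql⟩ := hst.energy hq hqH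
  obtain ⟨hpXi, hpX⟩ := xInt_integrable hst.Xmeas hp hpx
  obtain ⟨hqXi, hqX⟩ := xInt_integrable hst.Xmeas hq hqx
  have hXeq : (fun r => X r * ((1 - a) * p r + a * q r)) =
      fun r => (1 - a) * (X r * p r) + a * (X r * q r) := by
    funext r; ring
  have h := hst.feasible_of_le (p := fun r => (1 - a) * p r + a * q r)
    ((hp.1.const_mul _).add (hq.1.const_mul _))
    (fun r => add_nonneg (mul_nonneg (sub_nonneg.2 ha1) (hp.2.1 r)) (mul_nonneg ha0 (hq.2.1 r)))
    ((hp.integrable.const_mul _).add (hq.integrable.const_mul _))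
    (by
      rw [integral_add (hp.integrable.const_mul _) (hq.integrable.const_mul _),
        integral_const_mul, integral_const_mul, hp.integral_eq_one, hq.integral_eq_one]
      ring)
    (by rw [hXeq]; exact (hpXi.const_mul _).add (hqXi.const_mul _))
    ((hpi.const_mul (1 - a)).add (hqi.const_mul a))
    (by
      filter_upwards [hpt, hqt] with r h1 h2
      exact hst.convex_ereal r (hp.2.1 r) (hq.2.1 r) ha0 ha1 h1 h2)
  rw [hXeq, integral_add (hpXi.const_mul _) (hqXi.const_mul _), integral_const_mul,
    integral_const_mul, hpX, hqX] at h
  refine h.mono ?_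
  simp only [Pi.add_apply]
  rw [integral_add (hpi.const_mul _) (hqi.const_mul _), integral_const_mul,
    integral_const_mul]
  exact add_le_add (mul_le_mul_of_nonneg_left hpl (sub_nonneg.2 ha1))
    (mul_le_mul_of_nonneg_left hql ha0)

/-- An increasing exhaustion by sets of bounded values captures almost all of the measure. -/
theorem exists_lt_measure_inter_abs_le {S : Set Ω} (hS : MeasurableSet S) {g : Ω → ℝ}
    (hg : Measurable g) {c : ℝ≥0∞} (hc : c < μ S) :
    ∃ n : ℕ, MeasurableSet (S ∩ {r | |g r| ≤ n}) ∧ c < μ (S ∩ {r | |g r| ≤ n}) := by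
  have hmono : Monotone fun n : ℕ => S ∩ {r | |g r| ≤ n} := fun i j hij r hr =>
    ⟨hr.1, le_trans (show |g r| ≤ i from hr.2) (Nat.cast_le.2 hij)⟩
  have hU : ⋃ n : ℕ, S ∩ {r | |g r| ≤ n} = S := by
    ext r
    simp only [mem_iUnion, mem_inter_iff, mem_ofPred_eq]
    exact ⟨fun ⟨_, h, _⟩ => h, fun h => (exists_nat_ge |g r|).imp fun n hn => ⟨h, hn⟩⟩
  have ht := tendsto_measure_iUnion_atTop (μ := μ) hmono
  rw [hU] at ht
  obtain ⟨n, hn⟩ := (ht.eventually (lt_mem_nhds hc)).exists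
  exact ⟨n, hS.inter (measurableSet_le hg.abs measurable_const), hn⟩

/-- Payoffs attainable with finite divergence get arbitrarily close to the essential infimum. -/
theorem Standing.exists_feasible_lt (hst : Standing μ β β' X p₀ b₀) {b : ℝ}
    (hb : essInfX μ X < (b : EReal)) : ∃ x < b, ∃ h, Feasible μ β X x h := by
  have := hst.sigma
  obtain ⟨b', hb', hb'b⟩ := EReal.lt_iff_exists_real_btwn.1 hb
  have hb'b : b' < b := EReal.coe_lt_coe_iff.1 hb'b
  have hL : 0 < μ {r | X r < b'} := by
    rw [pos_iff_ne_zero]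
    intro h0
    refine absurd hb' (not_lt.2 (le_essInf_of_ae_le _ ?_))
    have : ∀ᵐ r ∂μ, ¬ X r < b' := by simpa [ae_iff] using h0
    filter_upwards [this] with r hr
    exact EReal.coe_le_coe_iff.2 (not_lt.1 hr)
  obtain ⟨S, hSm, hSL, hS0, hSt⟩ := Measure.exists_subset_measure_lt_top
    (measurableSet_lt hst.Xmeas measurable_const) hL
  have hSr : 0 < μ.real S := ENNReal.toReal_pos hS0.ne' hSt.ne
  set C : ℝ := 2 / μ.real S with hC
  have hC0 : 0 < C := by positivity
  have hp0 := hst.dens₀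
  have hp0m := hp0.1
  have hp0n := hp0.2.1
  have hgm : Measurable fun r => (β r (p₀ r + C)).toReal :=
    (hst.measurable_comp (hp0m.add_const C) fun r => add_nonneg (hp0n r) hC0.le).ereal_toReal
  obtain ⟨J, hBm, hB⟩ := exists_lt_measure_inter_abs_le hSm
    (g := fun r => max |X r| |(β r (p₀ r + C)).toReal|)
    (hst.Xmeas.abs.max hgm.abs) (ENNReal.half_lt_self hS0.ne' hSt.ne)
  set B := S ∩ {r | abs (max (abs (X r)) (abs (β r (p₀ r + C)).toReal)) ≤ J} with hBdef
  have hBt : μ B < ⊤ := lt_of_le_of_lt (measure_mono inter_subset_left) hSt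
  have hBX : ∀ r ∈ B, |X r| ≤ J := fun r hr =>
    (le_max_left _ _).trans ((le_abs_self _).trans hr.2)
  have hBg : ∀ r ∈ B, |(β r (p₀ r + C)).toReal| ≤ J := fun r hr =>
    (le_max_right _ _).trans ((le_abs_self _).trans hr.2)
  have hBb : ∀ r ∈ B, X r ≤ b' := fun r hr => le_of_lt (hSL hr.1)
  have hmB : μ.real S / 2 < μ.real B := by
    have := (ENNReal.toReal_lt_toReal (ENNReal.div_lt_top hSt.ne (by simp)).ne hBt.ne).2 hB
    simpa [ENNReal.toReal_div, Measure.real] using this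
  have hmB0 : 0 < μ.real B := by linarith
  have hmC : 1 / μ.real B ≤ C := by
    rw [hC, div_le_div_iff₀ hmB0 hSr]; linarith
  obtain ⟨hf0t, hf0i, -⟩ := hst.energy hp0 (h := 0) (by rw [hst.H₀]; simp)
  obtain ⟨hXi, hXb⟩ := xInt_integrable hst.Xmeas hp0 hst.payoff₀
  have hpi := hp0.integrable
  have hXB : IntegrableOn X B μ :=
    Measure.integrableOn_of_bounded (M := J) hBt.ne hst.Xmeas.aestronglyMeasurable
      ((ae_restrict_mem hBm).mono fun r hr => hBX r hr)
  set Y := ∫ r in Bᶜ, X r * p₀ r ∂μ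
  set a := ∫ r in Bᶜ, p₀ r ∂μ with ha
  have hsum1 : ∫ r in B, p₀ r ∂μ = 1 - a := by
    rw [← hp0.integral_eq_one, ← integral_add_compl hBm hpi]; ring
  have hsum2 : b₀ - Y ≤ b' * (1 - a) := by
    rw [← hXb, ← integral_add_compl hBm hXi, add_sub_cancel_right, ← hsum1,
      ← integral_const_mul]
    exact setIntegral_mono_on hXi.integrableOn (hpi.const_mul _).integrableOn hBm
      fun r hr => mul_le_mul_of_nonneg_right (hBb r hr) (hp0n r)
  obtain ⟨ε, hε0, hε1, hε⟩ : ∃ ε : ℝ, 0 < ε ∧ ε < 1 ∧ ε * |Y - b' * a| < b - b' := by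
    have hbb : 0 < b - b' := sub_pos.2 hb'b
    have hd : 0 < |Y - b' * a| + (b - b') + 1 := by positivity
    refine ⟨(b - b') / (|Y - b' * a| + (b - b') + 1), by positivity, ?_, ?_⟩
    · rw [div_lt_one hd]; linarith [abs_nonneg (Y - b' * a)]
    · rw [div_mul_eq_mul_div, div_lt_iff₀ hd]
      nlinarith [abs_nonneg (Y - b' * a)]
  have hem : Measurable fun r => (β r (ε * p₀ r)).toReal :=
    (hst.measurable_comp (hp0m.const_mul ε) fun r => mul_nonneg hε0.le (hp0n r)).ereal_toReal
  set E : ℕ → Set Ω := fun n => (spanningSets μ n ∩ {r | |(β r (ε * p₀ r)).toReal| ≤ n}) \ B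
    with hE
  have hEm : ∀ n, MeasurableSet (E n) := fun n =>
    ((measurableSet_spanningSets μ n).inter (measurableSet_le hem.abs measurable_const)).diff hBm
  have hEmono : Monotone E := fun i j hij r hr =>
    ⟨⟨monotone_spanningSets μ hij hr.1.1,
      le_trans (show |(β r (ε * p₀ r)).toReal| ≤ i from hr.1.2) (Nat.cast_le.2 hij)⟩, hr.2⟩
  have hEU : ⋃ n, E n = Bᶜ := by
    ext r
    simp only [mem_iUnion, mem_compl_iff]
    refine ⟨fun ⟨n, hn⟩ => hn.2, fun hr => ?_⟩
    have h1 : r ∈ ⋃ n, spanningSets μ n := by rw [iUnion_spanningSets]; trivial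
    obtain ⟨i, hi⟩ := mem_iUnion.1 h1
    obtain ⟨j, hj⟩ := exists_nat_ge |(β r (ε * p₀ r)).toReal|
    exact ⟨max i j, ⟨monotone_spanningSets μ (le_max_left i j) hi,
      hj.trans (Nat.cast_le.2 (le_max_right i j))⟩, hr⟩
  have hlim : Tendsto (fun n => b₀ - (1 - ε) * (∫ r in E n, X r * p₀ r ∂μ) +
      (1 - ε) * (∫ r in E n, p₀ r ∂μ) * b') atTop (𝓝 (b₀ - (1 - ε) * Y + (1 - ε) * a * b')) := by
    have h1 := tendsto_setIntegral_of_monotone hEm hEmono (f := fun r => X r * p₀ r)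
      hXi.integrableOn
    have h2 := tendsto_setIntegral_of_monotone hEm hEmono (f := p₀) hpi.integrableOn
    rw [hEU] at h1 h2
    exact (tendsto_const_nhds.sub (h1.const_mul _)).add ((h2.const_mul _).mul_const _)
  have hlt : b₀ - (1 - ε) * Y + (1 - ε) * a * b' < b := by
    have := mul_le_mul_of_nonneg_left (le_abs_self (Y - b' * a)) hε0.le
    linarith
  obtain ⟨n, hn⟩ := (hlim.eventually (gt_mem_nhds hlt)).exists
  set e := ∫ r in E n, p₀ r ∂μ with he
  have he0 : 0 ≤ e := integral_nonneg hp0n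
  have he1 : e ≤ 1 := by
    rw [← hp0.integral_eq_one]
    exact setIntegral_le_integral hpi (Eventually.of_forall hp0n)
  set c := (1 - ε) * e / μ.real B with hc
  have hc0 : 0 ≤ c := div_nonneg (mul_nonneg (by linarith) he0) hmB0.le
  have hcC : c ≤ C := by
    refine le_trans ?_ hmC
    rw [hc]
    gcongr
    nlinarith
  have hcm : c * μ.real B = (1 - ε) * e := div_mul_cancel₀ _ hmB0.ne'
  have hEB : ∀ r ∈ E n, r ∉ B := fun r hr => hr.2
  set p : Ω → ℝ := fun r => p₀ r - (1 - ε) * (E n).indicator p₀ r + c * B.indicator 1 r with hp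
  have hpB : ∀ r ∈ B, p r = p₀ r + c := fun r hr => by
    have : r ∉ E n := fun h => hEB r h hr
    simp [hp, hr, this]
  have hpE : ∀ r ∈ E n, p r = ε * p₀ r := fun r hr => by
    simp only [hp, indicator_of_mem hr, indicator_of_notMem (hEB r hr)]; ring
  have hpO : ∀ r, r ∉ E n → r ∉ B → p r = p₀ r := fun r h1 h2 => by
    simp [hp, h1, h2]
  have hBi : Integrable (B.indicator (1 : Ω → ℝ)) μ :=
    (integrable_indicator_iff hBm).2 (integrableOn_const hBt.ne)
  have hEi := hpi.indicator (hEm n)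
  have hEXi := hXi.indicator (hEm n)
  have hBXi := hXB.integrable_indicator hBm
  have hXp : (fun r => X r * p r) = fun r => X r * p₀ r -
      (1 - ε) * (E n).indicator (fun r => X r * p₀ r) r + c * B.indicator X r := by
    funext r
    by_cases h1 : r ∈ E n <;> by_cases h2 : r ∈ B <;> simp [hp, h1, h2] <;> ring
  have hfeas := hst.feasible_of_le (p := p)
    (G := fun r => |(β r (p₀ r)).toReal| +
      ((J : ℝ) + n) * (B ∪ spanningSets μ n).indicator 1 r)
    ((hp0m.sub ((hp0m.indicator (hEm n)).const_mul _)).add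
      ((measurable_one.indicator hBm).const_mul c))
    (by
      intro r
      by_cases h1 : r ∈ E n
      · rw [hpE r h1]; exact mul_nonneg hε0.le (hp0n r)
      by_cases h2 : r ∈ B
      · rw [hpB r h2]; exact add_nonneg (hp0n r) hc0
      · rw [hpO r h1 h2]; exact hp0n r)
    (integrable_sub_mul_add_mul hpi hEi hBi _ _)
    (by
      simp only [hp]
      rw [integral_sub_mul_add_mul hpi hEi hBi,
        integral_indicator (hEm n), integral_indicator_one hBm, hp0.integral_eq_one, hcm]
      ring)
    (by rw [hXp]; exact integrable_sub_mul_add_mul hXi hEXi hBXi _ _)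
    (by
      refine hf0i.abs.add (Integrable.const_mul ?_ _)
      exact (integrable_indicator_iff (hBm.union (measurableSet_spanningSets μ n))).2
        (integrableOn_const (measure_union_lt_top hBt (measure_spanningSets_lt_top μ n)).ne))
    (by
      filter_upwards [hf0t] with r hr
      have hn0 : (0:ℝ) ≤ n := Nat.cast_nonneg n
      have hJ0 : (0:ℝ) ≤ J := Nat.cast_nonneg J
      have hab := abs_nonneg (β r (p₀ r)).toReal
      by_cases h1 : r ∈ E n
      · have hfin : β r (ε * p₀ r) ≠ ⊤ := by
          rcases (hp0n r).eq_or_lt with h | h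
          · rw [← h] at hr ⊢; simpa using hr
          · exact hst.betaFin r _ (mul_pos hε0 h)
        rw [hpE r h1, ← EReal.coe_toReal hfin (hst.betaNeBot r _), EReal.coe_le_coe_iff,
          indicator_of_mem (mem_union_right B h1.1.1), Pi.one_apply, mul_one]
        have h2 : |(β r (ε * p₀ r)).toReal| ≤ n := h1.1.2
        linarith [le_abs_self (β r (ε * p₀ r)).toReal]
      by_cases h2 : r ∈ B
      · have hl0 : 0 ≤ c / C := div_nonneg hc0 hC0.le
        have hl1 : c / C ≤ 1 := (div_le_one hC0).2 hcC
        have h3 := hst.convex_ereal r (hp0n r) (add_nonneg (hp0n r) hC0.le) hl0 hl1 hr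
          (hst.betaFin r _ (add_pos_of_nonneg_of_pos (hp0n r) hC0))
        have h4 : (1 - c / C) * p₀ r + c / C * (p₀ r + C) = p₀ r + c := by
          field_simp; ring
        rw [h4] at h3
        rw [hpB r h2]
        refine h3.trans (EReal.coe_le_coe_iff.2 ?_)
        rw [indicator_of_mem (mem_union_left _ h2), Pi.one_apply, mul_one]
        have h5 := mul_le_mul_of_nonneg_left (le_abs_self (β r (p₀ r)).toReal) (sub_nonneg.2 hl1)
        have h6 := mul_le_mul_of_nonneg_left
          ((le_abs_self (β r (p₀ r + C)).toReal).trans (hBg r h2)) hl0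
        nlinarith
      · rw [hpO r h1 h2]
        refine (EReal.coe_toReal hr (hst.betaNeBot r _)).symm.le.trans
          (EReal.coe_le_coe_iff.2 ?_)
        have h3 : 0 ≤ (B ∪ spanningSets μ n).indicator (1 : Ω → ℝ) r :=
          indicator_nonneg (fun _ _ => zero_le_one) r
        have := mul_nonneg (add_nonneg hJ0 hn0) h3
        linarith [le_abs_self (β r (p₀ r)).toReal])
  refine ⟨_, ?_, _, hfeas⟩
  rw [hXp, integral_sub_mul_add_mul hXi hEXi hBXi,
    integral_indicator (hEm n), integral_indicator hBm, hXb]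
  have hXBle : ∫ r in B, X r ∂μ ≤ μ.real B * b' := by
    have := setIntegral_mono_on hXB (integrableOn_const (C := b') hBt.ne) hBm hBb
    simpa using this
  have := mul_le_mul_of_nonneg_left hXBle hc0
  rw [← mul_assoc, hcm] at this
  linarith

/-- A density of finite divergence whose payoff is `-∞` or undefined makes arbitrarily low
payoffs attainable at arbitrarily small divergence. -/
theorem Standing.exists_feasible_lt_of_xInt_eq_bot (hst : Standing μ β β' X p₀ b₀) {p : Ω → ℝ}
    (hp : IsDensity μ p) {h : ℝ} (hH : Hfun μ β p ≤ (h : EReal)) (hx : xInt μ X p = ⊥)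
    (b : ℝ) {ε : ℝ} (hε : 0 < ε) : ∃ x < b, Feasible μ β X x ε := by
  obtain ⟨hft, hfi, -⟩ := hst.energy hp hH
  have hp0 := hst.dens₀
  obtain ⟨hf0t, hf0i, hf0⟩ := hst.energy hp0 (h := 0) (by rw [hst.H₀]; simp)
  obtain ⟨hXi, hXb⟩ := xInt_integrable hst.Xmeas hp0 hst.payoff₀
  have hXm := hst.Xmeas
  set D := ∫ r, |(β r (p r)).toReal - (β r (p₀ r)).toReal| ∂μ with hD
  have hD0 : 0 ≤ D := integral_nonneg fun r => abs_nonneg _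
  obtain ⟨t, ht0, ht1, htD⟩ : ∃ t : ℝ, 0 < t ∧ t ≤ 1 ∧ t * D ≤ ε := by
    refine ⟨min 1 (ε / (D + 1)), by positivity, min_le_left _ _, ?_⟩
    calc min 1 (ε / (D + 1)) * D ≤ ε / (D + 1) * (D + 1) := by
          gcongr
          · exact min_le_right _ _
          · linarith
      _ = ε := div_mul_cancel₀ _ (by positivity)
  set u : Ω → ℝ := fun r => max (p r - p₀ r) 0 with hu
  set w : Ω → ℝ := fun r => max (p₀ r - p r) 0 with hw
  have hu0 : ∀ r, 0 ≤ u r := fun r => le_max_right _ _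
  have hw0 : ∀ r, 0 ≤ w r := fun r => le_max_right _ _
  have hwp : ∀ r, w r ≤ p₀ r := fun r => max_le (by linarith [hp.2.1 r]) (hp0.2.1 r)
  have huw : ∀ r, u r - w r = p r - p₀ r := fun r => by
    rcases le_total (p r) (p₀ r) with h | h
    · simp [hu, hw, h]
    · simp [hu, hw, h]
  have hum : Measurable u := (hp.1.sub hp0.1).max measurable_const
  have hwm : Measurable w := (hp0.1.sub hp.1).max measurable_const
  have hui : Integrable u μ := (hp.integrable.sub hp0.integrable).pos_part
  have hwi : Integrable w μ := (hp0.integrable.sub hp.integrable).pos_part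
  have huwi : ∫ r, u r ∂μ = ∫ r, w r ∂μ := by
    have h1 : ∫ r, (u r - w r) ∂μ = ∫ r, (p r - p₀ r) ∂μ := by simp only [huw]
    rw [integral_sub hui hwi, integral_sub hp.integrable hp0.integrable, hp.integral_eq_one,
      hp0.integral_eq_one] at h1
    linarith
  set δ := ∫ r, w r ∂μ with hδ
  have hδ0 : 0 ≤ δ := integral_nonneg hw0
  have hXwle : ∀ r, |X r * w r| ≤ |X r * p₀ r| := fun r => by
    rw [abs_mul, abs_mul, abs_of_nonneg (hw0 r), abs_of_nonneg (hp0.2.1 r)]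
    exact mul_le_mul_of_nonneg_left (hwp r) (abs_nonneg _)
  have hXwi : Integrable (fun r => X r * w r) μ :=
    hXi.mono (hXm.mul hwm).aestronglyMeasurable (Eventually.of_forall hXwle)
  set S : ℕ → Set Ω := fun n => {r | -(n:ℝ) ≤ X r ∧ X r ≤ 0} with hS
  have hSm : ∀ n, MeasurableSet (S n) := fun n =>
    (measurableSet_le measurable_const hXm).inter (measurableSet_le hXm measurable_const)
  have hUi : ∀ n, Integrable ((S n).indicator u) μ := fun n => hui.indicator (hSm n)
  have hXUi : ∀ n, Integrable (fun r => X r * (S n).indicator u r) μ := fun n => by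
    refine (hui.const_mul (n:ℝ)).mono' (hXm.mul (hum.indicator (hSm n))).aestronglyMeasurable
      (Eventually.of_forall fun r => ?_)
    by_cases hr : r ∈ S n
    · rw [indicator_of_mem hr, norm_mul, Real.norm_of_nonneg (hu0 r)]
      exact mul_le_mul_of_nonneg_right (abs_le.2 ⟨hr.1, hr.2.trans (Nat.cast_nonneg n)⟩) (hu0 r)
    · rw [indicator_of_notMem hr, mul_zero, norm_zero]
      exact mul_nonneg (Nat.cast_nonneg n) (hu0 r)
  have htop : ∫⁻ r, ENNReal.ofReal (-(X r * u r)) ∂μ = ⊤ := by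
    have h1 : ∫⁻ r, ENNReal.ofReal (-(X r * p r)) ∂μ = ⊤ := by
      by_contra hne
      simp only [xInt, eInt, ← EReal.coe_neg, ePos_coe] at hx
      rw [← EReal.coe_ennreal_toReal hne, sub_eq_add_neg, EReal.add_eq_bot_iff] at hx
      rcases hx with hx | hx
      · exact EReal.coe_ennreal_ne_bot _ hx
      · rw [← EReal.coe_neg] at hx
        exact EReal.coe_ne_bot _ hx
    by_contra hne
    have h2 : ∫⁻ r, ENNReal.ofReal (-(X r * p r)) ∂μ ≤
        ∫⁻ r, (ENNReal.ofReal (-(X r * u r)) + ENNReal.ofReal |X r * p₀ r|) ∂μ := by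
      refine lintegral_mono fun r => ?_
      rcases le_total 0 (X r) with hX0 | hX0
      · rw [ENNReal.ofReal_of_nonpos (neg_nonpos.2 (mul_nonneg hX0 (hp.2.1 r)))]
        exact zero_le
      · rw [← ENNReal.ofReal_add (by nlinarith [hu0 r]) (abs_nonneg _)]
        refine ENNReal.ofReal_le_ofReal ?_
        have h3 := huw r
        have h4 := neg_abs_le (X r * p₀ r)
        nlinarith [mul_nonneg (neg_nonneg.2 hX0) (hw0 r), congrArg (fun z => X r * z) h3]
    have hvm : Measurable fun r => ENNReal.ofReal (-(X r * u r)) :=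
      (hXm.mul hum).neg.ennreal_ofReal
    rw [h1, lintegral_add_left hvm, top_le_iff,
      ENNReal.add_eq_top] at h2
    exact h2.elim hne hXi.abs.lintegral_lt_top.ne
  have hbig : ∀ K : ℝ, ∃ n, ∫ r, X r * (S n).indicator u r ∂μ < -K := by
    intro K
    have hlim : Tendsto (fun n => ∫⁻ r, ENNReal.ofReal (-(X r * (S n).indicator u r)) ∂μ) atTop
        (𝓝 (∫⁻ r, ENNReal.ofReal (-(X r * u r)) ∂μ)) := by
      refine lintegral_tendsto_of_tendsto_of_monotone (fun n =>
        (hXm.mul (hum.indicator (hSm n))).neg.ennreal_ofReal.aemeasurable)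
        (Eventually.of_forall fun r i j hij => ?_) (Eventually.of_forall fun r => ?_)
      · refine ENNReal.ofReal_le_ofReal ?_
        by_cases hi : r ∈ S i
        · have hj : r ∈ S j := ⟨le_trans (neg_le_neg (Nat.cast_le.2 hij)) hi.1, hi.2⟩
          rw [indicator_of_mem hi, indicator_of_mem hj]
        · rw [indicator_of_notMem hi, mul_zero, neg_zero]
          by_cases hj : r ∈ S j
          · rw [indicator_of_mem hj]
            nlinarith [hu0 r, hj.2]
          · simp [hj]
      · rcases le_or_gt (X r) 0 with hX0 | hX0
        · obtain ⟨N, hN⟩ := exists_nat_ge (-X r)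
          refine tendsto_const_nhds.congr' ?_
          filter_upwards [eventually_ge_atTop N] with n hn
          have hn' : (N:ℝ) ≤ n := Nat.cast_le.2 hn
          rw [indicator_of_mem (show r ∈ S n from ⟨by linarith, hX0⟩)]
        · refine tendsto_const_nhds.congr fun n => ?_
          rw [indicator_of_notMem (show r ∉ S n from fun h => absurd h.2 (not_le.2 hX0)),
            ENNReal.ofReal_of_nonpos (neg_nonpos.2 (mul_nonneg hX0.le (hu0 r)))]
          simp
    rw [htop] at hlim
    obtain ⟨n, hn⟩ := (hlim.eventually (lt_mem_nhds (ENNReal.ofReal_lt_top (r := K)))).exists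
    refine ⟨n, ?_⟩
    have hnn : ∀ r, 0 ≤ -(X r * (S n).indicator u r) := fun r => by
      by_cases hr : r ∈ S n
      · rw [indicator_of_mem hr]
        nlinarith [hu0 r, hr.2]
      · simp [hr]
    rw [← ofReal_integral_eq_lintegral_ofReal (f := fun r => -(X r * (S n).indicator u r))
      (hXUi n).neg (Eventually.of_forall hnn),
      integral_neg] at hn
    have := (ENNReal.ofReal_lt_ofReal_iff').1 hn |>.1
    linarith
  set A := ∫ r, |X r * p₀ r| ∂μ with hA
  have hA0 : 0 ≤ A := integral_nonneg fun r => abs_nonneg _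
  obtain ⟨n, hn⟩ := hbig ((b₀ + A - b) / t)
  set un := ∫ r, (S n).indicator u r ∂μ with hun
  have hun0 : 0 ≤ un := integral_nonneg fun r => indicator_nonneg (fun r _ => hu0 r) r
  have hunδ : un ≤ δ := by
    rw [← huwi]
    exact integral_mono (hUi n) hui fun r => indicator_le_self' (fun r _ => hu0 r) r
  obtain ⟨s, hs0, hst', hsδ⟩ : ∃ s : ℝ, 0 ≤ s ∧ s ≤ t ∧ s * δ = t * un := by
    rcases hδ0.eq_or_lt with h | h
    · exact ⟨0, le_rfl, ht0.le, by rw [show un = 0 by linarith]; simp⟩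
    · refine ⟨t * un / δ, by positivity, ?_, div_mul_cancel₀ _ h.ne'⟩
      rw [div_le_iff₀ h]
      exact mul_le_mul_of_nonneg_left hunδ ht0.le
  set q : Ω → ℝ := fun r => p₀ r - s * w r + t * (S n).indicator u r with hq
  have hφ : ∀ r, ∃ φ : ℝ, 0 ≤ φ ∧ φ ≤ t ∧ q r = (1 - φ) * p₀ r + φ * p r := by
    intro r
    rcases le_total (p r) (p₀ r) with h | h
    · refine ⟨s, hs0, hst', ?_⟩
      have hur : u r = 0 := max_eq_right (by linarith)
      have hwr : w r = p₀ r - p r := max_eq_left (by linarith)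
      have : (S n).indicator u r = 0 := by by_cases hr : r ∈ S n <;> simp [hr, hur]
      simp only [hq, this, hwr]; ring
    · have hwr : w r = 0 := max_eq_right (by linarith)
      have hur : u r = p r - p₀ r := max_eq_left (by linarith)
      by_cases hr : r ∈ S n
      · refine ⟨t, ht0.le, le_rfl, ?_⟩
        simp only [hq, indicator_of_mem hr, hwr, hur]; ring
      · refine ⟨0, le_rfl, ht0.le, ?_⟩
        simp [hq, hr, hwr]
  have hXq : (fun r => X r * q r) = fun r => X r * p₀ r -
      s * (X r * w r) + t * (X r * (S n).indicator u r) := by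
    funext r; simp only [hq]; ring
  have hdi : Integrable (fun r => |(β r (p r)).toReal - (β r (p₀ r)).toReal|) μ :=
    (hfi.sub hf0i).abs
  have hfeas := hst.feasible_of_le (p := q)
    (G := fun r => (β r (p₀ r)).toReal + t * |(β r (p r)).toReal - (β r (p₀ r)).toReal|)
    ((hp0.1.sub (hwm.const_mul s)).add ((hum.indicator (hSm n)).const_mul t))
    (by
      intro r
      obtain ⟨φ, h0, h1, h2⟩ := hφ r
      rw [h2]
      exact add_nonneg (mul_nonneg (by linarith) (hp0.2.1 r)) (mul_nonneg h0 (hp.2.1 r)))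
    (integrable_sub_mul_add_mul hp0.integrable hwi (hUi n) _ _)
    (by
      simp only [hq]
      rw [integral_sub_mul_add_mul hp0.integrable hwi (hUi n), hp0.integral_eq_one]
      linarith)
    (by rw [hXq]; exact integrable_sub_mul_add_mul hXi hXwi (hXUi n) _ _)
    (hf0i.add (hdi.const_mul t))
    (by
      filter_upwards [hf0t, hft] with r h0 h1
      obtain ⟨φ, hφ0, hφt, hφq⟩ := hφ r
      rw [hφq]
      refine (hst.convex_ereal r (hp0.2.1 r) (hp.2.1 r) hφ0 (hφt.trans ht1) h0 h1).trans
        (EReal.coe_le_coe_iff.2 ?_)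
      have h2 := mul_le_mul_of_nonneg_left
        (le_abs_self ((β r (p r)).toReal - (β r (p₀ r)).toReal)) hφ0
      have h3 := mul_le_mul_of_nonneg_right hφt
        (abs_nonneg ((β r (p r)).toReal - (β r (p₀ r)).toReal))
      linarith)
  refine ⟨_, ?_, hfeas.mono ?_⟩
  · rw [hXq, integral_sub_mul_add_mul hXi hXwi (hXUi n), hXb]
    have h1 : -A ≤ ∫ r, X r * w r ∂μ := by
      rw [hA, ← integral_neg]
      exact integral_mono hXi.abs.neg hXwi fun r =>
        (neg_le_neg (hXwle r)).trans (neg_abs_le _)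
    have h2 : t * ∫ r, X r * (S n).indicator u r ∂μ < t * -((b₀ + A - b) / t) :=
      mul_lt_mul_of_pos_left hn ht0
    rw [mul_neg, mul_div_cancel₀ _ ht0.ne'] at h2
    have h3 := mul_le_mul_of_nonneg_left h1 hs0
    have h4 : s * A ≤ A := mul_le_of_le_one_left hA0 (hst'.trans ht1)
    linarith
  · rw [integral_add hf0i (hdi.const_mul t), integral_const_mul]
    exact (add_le_add hf0 htD).trans (by linarith)

theorem Feasible.Ffun_le {x h : ℝ} (hf : Feasible μ β X x h) : Ffun μ β X x ≤ (h : EReal) := by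
  obtain ⟨p, hp, hx, hH⟩ := hf
  exact (iInf_le (fun p : {p : Ω → ℝ // IsDensity μ p ∧ xInt μ X p = (x : EReal)} =>
    Hfun μ β p.1) ⟨p, hp, hx⟩).trans hH

theorem feasible_of_Ffun_lt {x h : ℝ} (hf : Ffun μ β X x < (h : EReal)) :
    Feasible μ β X x h := by
  obtain ⟨⟨p, hp, hx⟩, hH⟩ := iInf_lt_iff.1 hf
  exact ⟨p, hp, hx, hH.le⟩

theorem Feasible.Vfun_le {x h : ℝ} (hf : Feasible μ β X x h) : Vfun μ β X h ≤ (x : EReal) := by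
  obtain ⟨p, hp, hx, hH⟩ := hf
  rw [← hx]
  exact iInf_le (fun p : {p : Ω → ℝ // IsDensity μ p ∧ Hfun μ β p ≤ (h : EReal)} =>
    xInt μ X p.1) ⟨p, hp, hH⟩

theorem Feasible.segment (hst : Standing μ β β' X p₀ b₀) {x y z h k : ℝ}
    (hx : Feasible μ β X x h) (hy : Feasible μ β X y k) (hxz : x ≤ z) (hzy : z < y) :
    Feasible μ β X z ((1 - (z - x) / (y - x)) * h + (z - x) / (y - x) * k) := by
  have hxy : 0 < y - x := by linarith
  have := hx.convex hst hy (div_nonneg (sub_nonneg.2 hxz) hxy.le)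
    ((div_le_one hxy).2 (by linarith))
  convert this using 1
  field_simp
  ring

theorem Feasible.of_le (hst : Standing μ β β' X p₀ b₀) {x z h : ℝ}
    (hx : Feasible μ β X x h) (hxz : x ≤ z) (hz : z < b₀) : Feasible μ β X z h := by
  refine (hx.segment hst hst.feasible_base hxz hz).mono ?_
  have : 0 ≤ (z - x) / (b₀ - x) := div_nonneg (by linarith) (by linarith)
  nlinarith [hx.nonneg hst]

/-- A positive value of `F` is taken at most once to the left of `b₀`. -/
theorem Standing.Ffun_lt_of_lt (hst : Standing μ β β' X p₀ b₀) {x z k : ℝ} (hk : 0 < k)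
    (hxz : x < z) (hz : z < b₀) (hx : Ffun μ β X x = (k : EReal)) :
    Ffun μ β X z < (k : EReal) := by
  set s := (z - x) / (b₀ - x) with hs
  have hs0 : 0 < s := div_pos (by linarith) (by linarith)
  have hf : Feasible μ β X x (k + s * k) :=
    feasible_of_Ffun_lt (by rw [hx]; exact EReal.coe_lt_coe_iff.2 (by nlinarith))
  refine (hf.segment hst hst.feasible_base hxz.le hz).Ffun_le.trans_lt
    (EReal.coe_lt_coe_iff.2 ?_)
  rw [← hs]
  nlinarith [mul_pos (mul_pos hs0 hs0) hk]

end Standing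

/-- Lemma 1 of the paper. For each `k ∈ (0, k_max)` there is a unique
`b ∈ (m, b₀)` with `F(b) = k`, and then `V(k) = b`; the infimum defining `V(k)` is
attained by some density iff that defining `F(b)` is, and the same density attains both. -/
theorem lemma1_V_eq_F {Ω : Type*} [MeasurableSpace Ω] (μ : Measure Ω)
    (β : Ω → ℝ → EReal) (β' : Ω → ℝ → ℝ) (X : Ω → ℝ) (p₀ : Ω → ℝ) (b₀ : ℝ)
    (hst : Standing μ β β' X p₀ b₀)
    (k : ℝ) (hk0 : 0 < k) (hkmax : (k : EReal) < kmax μ β X b₀) :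
    ∃ b : ℝ,
      (essInfX μ X < (b : EReal) ∧ b < b₀ ∧ Ffun μ β X b = (k : EReal)) ∧
      (∀ b' : ℝ, essInfX μ X < (b' : EReal) → b' < b₀ → Ffun μ β X b' = (k : EReal) →
        b' = b) ∧
      Vfun μ β X k = (b : EReal) ∧
      ((∃ p : Ω → ℝ, IsDensity μ p ∧ Hfun μ β p ≤ (k : EReal) ∧
          xInt μ X p = Vfun μ β X k) ↔
        (∃ p : Ω → ℝ, IsDensity μ p ∧ xInt μ X p = (b : EReal) ∧
          Hfun μ β p = Ffun μ β X b)) ∧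
      (∀ p : Ω → ℝ, IsDensity μ p →
        ((Hfun μ β p ≤ (k : EReal) ∧ xInt μ X p = Vfun μ β X k) ↔
          (xInt μ X p = (b : EReal) ∧ Hfun μ β p = Ffun μ β X b))) := by

  have hmk : ∃ b₁ : ℝ, essInfX μ X < (b₁ : EReal) ∧ b₁ < b₀ ∧ (k : EReal) < Ffun μ β X b₁ := by
    obtain ⟨⟨b₁, h1, h2⟩, h3⟩ := lt_iSup_iff.1 hkmax
    exact ⟨b₁, h1, h2, h3⟩
  obtain ⟨b₁, hmb₁, hb₁, hkb₁⟩ := hmk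
  have hlow : ∀ x, Feasible μ β X x k → b₁ < x := fun x hx => by
    by_contra! hle
    exact absurd (hx.of_le hst hle hb₁).Ffun_le (not_le.2 hkb₁)
  have hbase : Feasible μ β X b₀ k := hst.feasible_base.mono hk0.le
  set T : Set ℝ := {x | Feasible μ β X x k} with hT
  have hTbdd : BddBelow T := ⟨b₁, fun x hx => (hlow x hx).le⟩
  have hTne : T.Nonempty := ⟨b₀, hbase⟩
  set b := sInf T with hb
  have hb₁b : b₁ ≤ b := le_csInf hTne fun x hx => (hlow x hx).le
  have hmb : essInfX μ X < (b : EReal) := hmb₁.trans_le (EReal.coe_le_coe_iff.2 hb₁b)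
  obtain ⟨y, hyb, h, hy⟩ := hst.exists_feasible_lt hmb
  have hh0 := hy.nonneg hst
  have hkh : k < h := by
    by_contra! hle
    exact absurd (csInf_le hTbdd (hy.mono hle)) (not_le.2 hyb)
  have hbb₀ : b < b₀ := by
    by_contra! hle
    have hyb₀ : y < b₀ := by
      linarith [csInf_le hTbdd (show b₀ ∈ T from hbase)]
    have hc := hst.feasible_base.convex hst hy (a := k / h) (by positivity)
      ((div_le_one (by linarith)).2 hkh.le)
    rw [mul_zero, zero_add, div_mul_cancel₀ k (by linarith : h ≠ 0)] at hc
    have h1 := csInf_le hTbdd hc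
    have h2 : 0 < k / h := div_pos hk0 (by linarith)
    nlinarith
  have hFb_ge : (k : EReal) ≤ Ffun μ β X b := by
    by_contra! hlt
    obtain ⟨k', hk'1, hk'2⟩ := EReal.lt_iff_exists_real_btwn.1 hlt
    have hk'k : k' < k := EReal.coe_lt_coe_iff.1 hk'2
    have hf := feasible_of_Ffun_lt hk'1
    have hk'0 := hf.nonneg hst
    have ha0 : 0 < (k - k') / (h - k') := div_pos (by linarith) (by linarith)
    have hc := hf.convex hst hy ha0.le ((div_le_one (by linarith)).2 (by linarith))
    have hval : (1 - (k - k') / (h - k')) * k' + (k - k') / (h - k') * h = k := by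
      have : h - k' ≠ 0 := by linarith
      field_simp
      ring
    rw [hval] at hc
    have h1 := csInf_le hTbdd hc
    nlinarith
  have hFb_le : Ffun μ β X b ≤ (k : EReal) := by
    by_contra! hlt
    obtain ⟨k', hk'1, hk'2⟩ := EReal.lt_iff_exists_real_btwn.1 hlt
    have hkk' : k < k' := EReal.coe_lt_coe_iff.1 hk'1
    have hgap : 0 < (k' - k) * (b - y) / h :=
      div_pos (mul_pos (by linarith) (by linarith)) (by linarith)
    obtain ⟨x, hx, hxb⟩ := exists_lt_of_csInf_lt hTne (show sInf T < b + (k' - k) * (b - y) / h by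
      linarith)
    have hbx : b ≤ x := csInf_le hTbdd hx
    rcases hbx.eq_or_lt with hbx | hbx
    · have hx' : Feasible μ β X b k := by rw [hbx]; exact hx
      exact absurd (hx'.Ffun_le.trans_lt hk'1) (not_lt.2 hk'2.le)
    have hs := hy.segment hst hx hyb.le hbx
    refine absurd (hs.Ffun_le.trans (EReal.coe_le_coe_iff.2 ?_)) (not_le.2 hk'2)
    have hxy : 0 < x - y := by linarith
    have h1 : (1 - (b - y) / (x - y)) * h + (b - y) / (x - y) * k =
        ((x - b) * h + (b - y) * k) / (x - y) := by
      field_simp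
      ring
    rw [h1, div_le_iff₀ hxy]
    have h2 : x - b < (k' - k) * (b - y) / h := by linarith
    rw [lt_div_iff₀ (by linarith)] at h2
    nlinarith
  have hFb := le_antisymm hFb_le hFb_ge
  have hVb : Vfun μ β X k = (b : EReal) := by
    refine le_antisymm ?_ ?_
    · refine EReal.le_of_forall_lt_iff_le.1 fun z hz => ?_
      obtain ⟨x, hx, hxz⟩ := exists_lt_of_csInf_lt hTne (EReal.coe_lt_coe_iff.1 hz)
      exact hx.Vfun_le.trans (EReal.coe_le_coe_iff.2 hxz.le)
    · refine le_iInf fun ⟨p, hp, hH⟩ => ?_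
      induction hx : xInt μ X p with
      | bot =>
        obtain ⟨x, hxb, hx⟩ := hst.exists_feasible_lt_of_xInt_eq_bot hp hH hx b hk0
        exact absurd (csInf_le hTbdd hx) (not_le.2 hxb)
      | top => exact le_top
      | coe x => exact EReal.coe_le_coe_iff.2 (csInf_le hTbdd ⟨p, hp, hx, hH⟩)
  have hiff : ∀ p : Ω → ℝ, IsDensity μ p →
      ((Hfun μ β p ≤ (k : EReal) ∧ xInt μ X p = Vfun μ β X k) ↔
        (xInt μ X p = (b : EReal) ∧ Hfun μ β p = Ffun μ β X b)) := by
    intro p hp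
    rw [hVb, hFb]
    refine ⟨fun ⟨hH, hx⟩ => ⟨hx, hH.antisymm ?_⟩, fun ⟨hx, hH⟩ => ⟨hH.le, hx⟩⟩
    rw [← hFb]
    exact iInf_le (fun p : {p : Ω → ℝ // IsDensity μ p ∧ xInt μ X p = (b : EReal)} =>
      Hfun μ β p.1) ⟨p, hp, hx⟩
  refine ⟨b, ⟨hmb, hbb₀, hFb⟩, fun b' _ hb' hFb' => ?_, hVb,
    exists_congr fun p => and_congr_right fun hp => hiff p hp, hiff⟩
  rcases lt_trichotomy b' b with hlt | heq | hlt
  · exact absurd hFb (hst.Ffun_lt_of_lt hk0 hlt hbb₀ hFb').ne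
  · exact heq
  · exact absurd hFb' (hst.Ffun_lt_of_lt hk0 hlt hb' hFb).ne
end

section
/- Given any θ₂ ∈ Θ₂, exactly one of the following holds: (i) some θ̄₁ ∈ ℝ satisfies (θ̄₁, θ₂) ∈ Θ and ∫ p_{θ̄₁,θ₂} dμ = 1; or (ii) θ̃₁ := sup{θ₁ : (θ₁,θ₂) ∈ dom K} is finite, (θ̃₁, θ₂) ∈ Θ, and ∫ p_{θ̃₁,θ₂} dμ < 1. In either case the infimum defining G(θ₂) is attained, and its unique minimiser is θ̄₁ in case (i), respectively θ̃₁ in case (ii). -/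
open MeasureTheory Filter Set Topology
open scoped ENNReal

namespace Standing

variable {Ω : Type*} [MeasurableSpace Ω] {μ : Measure Ω} {β : Ω → ℝ → EReal}
  {β' ψ : Ω → ℝ → ℝ} {X p₀ : Ω → ℝ} {b₀ : ℝ}

section Conjugate

variable {r : Ω} {s τ τ' x : ℝ}

theorem coe_toReal_beta (hst : Standing μ β β' X p₀ b₀) (hs : 0 < s) :
    ((β r s).toReal : EReal) = β r s :=
  EReal.coe_toReal (hst.betaFin r s hs) (hst.betaNeBot r s)

theorem coe_le_conj (hst : Standing μ β β' X p₀ b₀) (hs : 0 < s) :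
    ((s * τ - (β r s).toReal : ℝ) : EReal) ≤ conjβ β r τ := by
  rw [EReal.coe_sub, hst.coe_toReal_beta hs]
  exact le_iSup (fun s : ℝ => ((s * τ : ℝ) : EReal) - β r s) s

theorem le_of_conj_le (hst : Standing μ β β' X p₀ b₀) (hs : 0 < s) (h : conjβ β r τ ≤ x) :
    s * τ - (β r s).toReal ≤ x :=
  EReal.coe_le_coe_iff.1 ((hst.coe_le_conj hs).trans h)

theorem conj_ne_bot (hst : Standing μ β β' X p₀ b₀) : conjβ β r τ ≠ ⊥ := fun h => by
  have := hst.coe_le_conj (r := r) (τ := τ) one_pos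
  rw [h, le_bot_iff] at this
  exact EReal.coe_ne_bot _ this

/-- It suffices to bound the terms of the supremum defining the conjugate at positive `s`. -/
theorem conj_le (hst : Standing μ β β' X p₀ b₀)
    (h : ∀ s : ℝ, 0 < s → s * τ - (β r s).toReal ≤ x) : conjβ β r τ ≤ x := by
  refine iSup_le fun s => ?_
  rcases lt_trichotomy s 0 with hs | rfl | hs
  · simp [hst.betaNeg r s hs]
  · have h1 : ∀ᶠ s in 𝓝[>] (0 : ℝ), ((s * τ - x : ℝ) : EReal) ≤ β r s := by
      filter_upwards [self_mem_nhdsWithin] with s hs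
      rw [← hst.coe_toReal_beta hs, EReal.coe_le_coe_iff]
      linarith [h s hs]
    have h2 : Tendsto (fun s : ℝ => ((s * τ - x : ℝ) : EReal)) (𝓝[>] 0)
        (𝓝 ((0 * τ - x : ℝ) : EReal)) := by
      refine (continuous_coe_real_ereal.tendsto _).comp (Tendsto.mono_left ?_ nhdsWithin_le_nhds)
      exact Continuous.tendsto (by fun_prop) 0
    have h3 := le_of_tendsto_of_tendsto h2 (hst.betaZero r) h1
    induction hb : β r 0 using EReal.rec with
    | bot => exact absurd hb (hst.betaNeBot r 0)
    | top => simp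
    | coe y =>
      rw [hb, EReal.coe_le_coe_iff] at h3
      rw [← EReal.coe_sub, EReal.coe_le_coe_iff]
      linarith
  · rw [← hst.coe_toReal_beta hs, ← EReal.coe_sub, EReal.coe_le_coe_iff]
    exact h s hs

theorem conj_eq_iSup_rat (hst : Standing μ β β' X p₀ b₀) :
    conjβ β r τ = ⨆ q : {q : ℚ // 0 < q},
      ((((q : ℚ) : ℝ) * τ - (β r (q : ℚ)).toReal : ℝ) : EReal) := by
  refine le_antisymm ?_ (iSup_le fun q => hst.coe_le_conj (by exact_mod_cast q.2))
  refine le_of_forall_ge fun c hc => ?_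
  have hq : ∀ q : ℚ, 0 < q → (((q : ℝ) * τ - (β r q).toReal : ℝ) : EReal) ≤ c := fun q hq =>
    (le_iSup (fun q : {q : ℚ // 0 < q} =>
      ((((q : ℚ) : ℝ) * τ - (β r (q : ℚ)).toReal : ℝ) : EReal)) ⟨q, hq⟩).trans hc
  induction c using EReal.rec with
  | top => exact le_top
  | bot => exact absurd (le_bot_iff.1 (hq 1 one_pos)) (EReal.coe_ne_bot _)
  | coe x =>
    refine hst.conj_le fun s hs => ?_
    by_contra! hlt
    have hcont : ContinuousAt (fun s => s * τ - (β r s).toReal) s :=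
      (continuousAt_id.mul continuousAt_const).sub (hst.betaDeriv r s hs).continuousAt
    have hev := (hcont.eventually (lt_mem_nhds hlt)).and (lt_mem_nhds hs)
    obtain ⟨l, u, ⟨hl, hu⟩, hsub⟩ := mem_nhds_iff_exists_Ioo_subset.1 hev
    obtain ⟨q, hlq, hqu⟩ := exists_rat_btwn (hl.trans hu)
    obtain ⟨h1, h2⟩ := hsub ⟨hlq, hqu⟩
    have := EReal.coe_le_coe_iff.1 (hq q (by exact_mod_cast h2))
    exact absurd h1 (not_lt.2 this)

theorem conj_mono (hst : Standing μ β β' X p₀ b₀) : Monotone (conjβ β r) := by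
  intro τ τ' h
  rw [hst.conj_eq_iSup_rat, hst.conj_eq_iSup_rat]
  refine iSup_mono fun q => EReal.coe_le_coe_iff.2 ?_
  have : (0 : ℝ) < (q : ℚ) := by exact_mod_cast q.2
  gcongr

theorem conj_convex (hst : Standing μ β β' X p₀ b₀) {a b y : ℝ} (ha : 0 ≤ a) (hb : 0 ≤ b)
    (hab : a + b = 1) (hx : conjβ β r τ ≤ x) (hy : conjβ β r τ' ≤ y) :
    conjβ β r (a * τ + b * τ') ≤ ((a * x + b * y : ℝ) : EReal) := by
  refine hst.conj_le fun s hs => ?_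
  have h1 := mul_le_mul_of_nonneg_left (hst.le_of_conj_le hs hx) ha
  have h2 := mul_le_mul_of_nonneg_left (hst.le_of_conj_le hs hy) hb
  have h3 : (β r s).toReal = a * (β r s).toReal + b * (β r s).toReal := by
    rw [← add_mul, hab, one_mul]
  nlinarith

theorem tangent_le (hst : Standing μ β β' X p₀ b₀) (hs : 0 < s) {u : ℝ} (hu : 0 < u) :
    (β r s).toReal + β' r s * (u - s) ≤ (β r u).toReal := by
  have hc := (hst.betaConv r).convexOn
  rcases lt_trichotomy s u with h | rfl | h
  · have := hc.le_slope_of_hasDerivAt (mem_Ioi.2 hs) (mem_Ioi.2 hu) h (hst.betaDeriv r s hs)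
    rw [slope_def_field, le_div_iff₀ (sub_pos.2 h)] at this
    linarith
  · simp
  · have := hc.slope_le_of_hasDerivAt (mem_Ioi.2 hu) (mem_Ioi.2 hs) h (hst.betaDeriv r s hs)
    rw [slope_def_field, div_le_iff₀ (sub_pos.2 h)] at this
    linarith

theorem deriv_lt_deriv (hst : Standing μ β β' X p₀ b₀) (hs : 0 < s) {u : ℝ} (hu : s < u) :
    β' r s < β' r u := by
  have hc := hst.betaConv r
  exact (hc.lt_slope_of_hasDerivAt (mem_Ioi.2 hs) (mem_Ioi.2 (hs.trans hu)) hu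
    (hst.betaDeriv r s hs)).trans (hc.slope_lt_of_hasDerivAt (mem_Ioi.2 hs)
    (mem_Ioi.2 (hs.trans hu)) hu (hst.betaDeriv r u (hs.trans hu)))

theorem conj_le_of_deriv_le (hst : Standing μ β β' X p₀ b₀) (hs : 0 < s) (h1 : β' r s ≤ τ')
    (h2 : τ' ≤ τ) (hx : conjβ β r τ ≤ x) :
    conjβ β r τ' ≤ ((x - s * (τ - τ') : ℝ) : EReal) := by
  refine hst.conj_le fun u hu => ?_
  rcases le_total s u with h | h
  · nlinarith [hst.le_of_conj_le hu hx]
  · nlinarith [hst.le_of_conj_le hs hx, hst.tangent_le (r := r) hs hu]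

theorem conj_le_of_le_deriv (hst : Standing μ β β' X p₀ b₀) (hs : 0 < s) (h1 : τ' ≤ β' r s)
    (h2 : τ ≤ τ') (hx : conjβ β r τ ≤ x) :
    conjβ β r τ' ≤ ((x + s * (τ' - τ) : ℝ) : EReal) := by
  refine hst.conj_le fun u hu => ?_
  rcases le_total u s with h | h
  · nlinarith [hst.le_of_conj_le hu hx]
  · nlinarith [hst.le_of_conj_le hs hx, hst.tangent_le (r := r) hs hu]

theorem deriv_lt (hst : Standing μ β β' X p₀ b₀) (hs : 0 < s) (hτ : ¬ (τ : EReal) < derivTop β' r) :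
    β' r s < τ := by
  refine (hst.deriv_lt_deriv hs (lt_add_one s)).trans_le (EReal.coe_le_coe_iff.1 ?_)
  exact (le_iSup (fun s : {s : ℝ // 0 < s} => (β' r s : EReal)) ⟨s + 1, by positivity⟩).trans
    (not_lt.1 hτ)

/-- The slopes of the conjugate over two disjoint intervals differ, unless they vanish. -/
theorem chord_lt_chord (hst : Standing μ β β' X p₀ b₀) {h x₀ x₁ x₂ x₃ : ℝ} (hh : 0 < h)
    (h₀ : conjβ β r τ = x₀) (h₁ : conjβ β r (τ + h) = x₁) (h₂ : conjβ β r (τ + 2 * h) = x₂)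
    (h₃ : conjβ β r (τ + 3 * h) = x₃) (hlt : x₀ < x₁) : x₁ - x₀ < x₃ - x₂ := by
  by_contra! hle
  set v := (x₁ - x₀) / h with hv
  have hvx : v * h = x₁ - x₀ := by rw [hv]; field_simp
  have hvpos : 0 < v := div_pos (sub_pos.2 hlt) hh
  have hA : ∀ s, 0 < s → β' r s ≤ τ + 2 * h → s ≤ v := fun s hs hb => by
    have := hst.conj_le_of_deriv_le hs hb (by linarith) h₃.le
    rw [h₂, EReal.coe_le_coe_iff] at this
    refine le_of_mul_le_mul_right ?_ hh
    linarith
  have hB : ∀ s, 0 < s → τ + h ≤ β' r s → v ≤ s := fun s hs hb => by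
    have := hst.conj_le_of_le_deriv hs hb (by linarith) h₀.le
    rw [h₁, EReal.coe_le_coe_iff] at this
    refine le_of_mul_le_mul_right ?_ hh
    linarith
  have hv2 : 0 < v / 2 := by positivity
  have hv3 : 0 < 2 * v := by positivity
  have hlo : β' r (v / 2) < τ + h := by
    by_contra! hc; linarith [hB _ hv2 hc]
  have hhi : τ + 2 * h < β' r (2 * v) := by
    by_contra! hc; linarith [hA _ hv3 hc]
  have hivt : ∀ m, τ + h ≤ m → m ≤ τ + 2 * h → β' r v = m := fun m h1 h2 => by
    obtain ⟨s, hs, hsm⟩ := exists_hasDerivWithinAt_eq_of_gt_of_lt (a := v / 2) (b := 2 * v)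
      (f' := β' r) (by linarith)
      (fun s hs => (hst.betaDeriv r s (hv2.trans_le hs.1)).hasDerivWithinAt)
      (hlo.trans_le h1) (h2.trans_lt hhi)
    have hs0 : 0 < s := hv2.trans hs.1
    rw [← hsm, le_antisymm (hB s hs0 (by linarith)) (hA s hs0 (by linarith))]
  linarith [hivt (τ + h) le_rfl (by linarith), hivt (τ + 2 * h) (by linarith) le_rfl]

end Conjugate

section Integrals

theorem _root_.ePos_coe_s1 (x : ℝ) : ePos (x : EReal) = ENNReal.ofReal x := by
  simp [ePos]

theorem _root_.ePos_mono : Monotone ePos := by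
  intro x y h
  by_cases hy : y = ⊤
  · simp [ePos, hy]
  have hx : x ≠ ⊤ := ne_top_of_le_ne_top hy h
  by_cases hb : x = ⊥
  · simp [ePos, hb]
  · rw [ePos, ePos, if_neg hx, if_neg hy]
    exact ENNReal.ofReal_le_ofReal (EReal.toReal_le_toReal h hb hy)

theorem _root_.measurable_ePos : Measurable ePos := ePos_mono.measurable

theorem _root_.ne_top_of_coe_ennreal_sub_eq {a b : ℝ≥0∞} {x : ℝ}
    (h : (a : EReal) - (b : EReal) = x) : a ≠ ⊤ ∧ b ≠ ⊤ := by
  have hb : b ≠ ⊤ := by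
    rintro rfl
    simp at h
  refine ⟨?_, hb⟩
  rintro rfl
  lift b to NNReal using hb
  rw [EReal.coe_ennreal_top, ENNReal.coe_nnreal_eq, EReal.coe_ennreal_ofReal,
    EReal.top_sub_coe] at h
  exact EReal.top_ne_coe _ h

theorem _root_.eInt_eq_integral {f : Ω → EReal} {g : Ω → ℝ} (hfg : ∀ᵐ r ∂μ, f r = g r)
    (hg : Integrable g μ) : eInt μ f = ((∫ r, g r ∂μ : ℝ) : EReal) := by
  have h1 : ∫⁻ r, ePos (f r) ∂μ = ∫⁻ r, ENNReal.ofReal (g r) ∂μ :=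
    lintegral_congr_ae (hfg.mono fun r hr => by simp only [hr, ePos_coe_s1])
  have h2 : ∫⁻ r, ePos (-(f r)) ∂μ = ∫⁻ r, ENNReal.ofReal (-(g r)) ∂μ :=
    lintegral_congr_ae (hfg.mono fun r hr => by simp only [hr, ← EReal.coe_neg, ePos_coe_s1])
  rw [eInt, h1, h2, integral_eq_lintegral_pos_part_sub_lintegral_neg_part hg, EReal.coe_sub,
    EReal.coe_ennreal_toReal hg.lintegral_lt_top.ne,
    EReal.coe_ennreal_toReal (x := ∫⁻ r, ENNReal.ofReal (-(g r)) ∂μ) hg.neg.lintegral_lt_top.ne]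

theorem measurable_conj (hst : Standing μ β β' X p₀ b₀) {g : Ω → ℝ} (hg : Measurable g) :
    Measurable fun r => conjβ β r (g r) := by
  simp_rw [hst.conj_eq_iSup_rat]
  refine Measurable.iSup fun q => ?_
  exact ((measurable_const.mul hg).sub (hst.betaMeas _).ereal_toReal).coe_real_ereal

theorem integrable_p₀ (hst : Standing μ β β' X p₀ b₀) : Integrable p₀ μ := by
  refine ⟨hst.dens₀.1.aestronglyMeasurable, ?_⟩
  rw [hasFiniteIntegral_iff_ofReal (ae_of_all _ hst.dens₀.2.1), hst.dens₀.2.2]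
  exact ENNReal.one_lt_top

theorem integrable_X_mul_p₀ (hst : Standing μ β β' X p₀ b₀) :
    Integrable (fun r => X r * p₀ r) μ := by
  obtain ⟨h1, h2⟩ := ne_top_of_coe_ennreal_sub_eq hst.payoff₀
  simp only [← EReal.coe_neg, ePos_coe_s1] at h1 h2
  refine ⟨(hst.Xmeas.mul hst.dens₀.1).aestronglyMeasurable, ?_⟩
  rw [hasFiniteIntegral_iff_norm]
  refine (lintegral_mono fun r => ?_).trans_lt
    ((lintegral_add_left (hst.Xmeas.mul hst.dens₀.1).ennreal_ofReal _).trans_lt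
      (ENNReal.add_lt_top.2 ⟨h1.lt_top, h2.lt_top⟩))
  rw [Real.norm_eq_abs]
  rcases abs_cases (X r * p₀ r) with ⟨h, _⟩ | ⟨h, _⟩ <;> rw [h]
  · exact le_self_add
  · exact le_add_self

theorem lintegral_ePos_neg_conj_ne_top (hst : Standing μ β β' X p₀ b₀) (t θ₂ : ℝ) :
    ∫⁻ r, ePos (-(conjβ β r (t + θ₂ * X r))) ∂μ ≠ ⊤ := by
  have hH : ∫⁻ r, ePos (β r (p₀ r)) ∂μ ≠ ⊤ :=
    (ne_top_of_coe_ennreal_sub_eq (x := 0) hst.H₀).1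
  have hint : Integrable (fun r => -(p₀ r * (t + θ₂ * X r))) μ := by
    refine ((hst.integrable_p₀.const_mul (-t)).add
      (hst.integrable_X_mul_p₀.const_mul (-θ₂))).congr (ae_of_all _ fun r => ?_)
    simp only [Pi.add_apply]
    ring
  have hmeas : Measurable fun r => ENNReal.ofReal (-(p₀ r * (t + θ₂ * X r))) :=
    (hst.dens₀.1.mul (measurable_const.add (hst.Xmeas.const_mul _))).neg.ennreal_ofReal
  refine ((lintegral_mono fun r => ?_).trans_lt ((lintegral_add_right _ hmeas).trans_lt
    (ENNReal.add_lt_top.2 ⟨hH.lt_top, hint.lintegral_lt_top⟩))).ne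
  have hle := le_iSup (fun s : ℝ => ((s * (t + θ₂ * X r) : ℝ) : EReal) - β r s) (p₀ r)
  induction hb : β r (p₀ r) using EReal.rec with
  | bot => exact absurd hb (hst.betaNeBot _ _)
  | top => simp [ePos]
  | coe y =>
    simp only [hb] at hle
    rw [← EReal.coe_sub] at hle
    refine (ePos_mono (EReal.neg_le_neg_iff.2 hle)).trans ?_
    rw [← EReal.coe_neg, ePos_coe_s1, ePos_coe_s1, neg_sub, sub_eq_add_neg]
    exact ENNReal.ofReal_add_le

end Integrals

/-- The integrand of `K` as a real-valued function. -/
noncomputable def _root_.conjReal (β : Ω → ℝ → EReal) (X : Ω → ℝ) (θ₂ t : ℝ) (r : Ω) : ℝ :=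
  (conjβ β r (t + θ₂ * X r)).toReal

section Domain

variable {θ₂ t t' : ℝ}

theorem mem_domK_of_le (hst : Standing μ β β' X p₀ b₀) {u : Ω → ℝ} (hu : Integrable u μ)
    (h : ∀ᵐ r ∂μ, conjβ β r (t + θ₂ * X r) ≤ u r) : (t, θ₂) ∈ domK μ β X := by
  have h1 : ∫⁻ r, ePos (conjβ β r (t + θ₂ * X r)) ∂μ < ⊤ := by
    refine (lintegral_mono_ae (h.mono fun r hr => ?_)).trans_lt hu.lintegral_lt_top
    exact (ePos_mono hr).trans (ePos_coe_s1 _).le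
  have h2 := hst.lintegral_ePos_neg_conj_ne_top t θ₂
  change eInt _ _ < ⊤
  rw [eInt, ← EReal.coe_ennreal_toReal h1.ne, ← EReal.coe_ennreal_toReal h2, ← EReal.coe_sub]
  exact EReal.coe_lt_top _

theorem domK_facts (hst : Standing μ β β' X p₀ b₀) (ht : (t, θ₂) ∈ domK μ β X) :
    (∀ᵐ r ∂μ, conjβ β r (t + θ₂ * X r) = conjReal β X θ₂ t r) ∧
      Integrable (conjReal β X θ₂ t) μ := by
  have hm : Measurable fun r => conjβ β r (t + θ₂ * X r) :=
    hst.measurable_conj (measurable_const.add (hst.Xmeas.const_mul _))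
  have h2 := hst.lintegral_ePos_neg_conj_ne_top t θ₂
  have h1 : ∫⁻ r, ePos (conjβ β r (t + θ₂ * X r)) ∂μ ≠ ⊤ := fun h => by
    have ht' : eInt μ _ < ⊤ := ht
    rw [eInt, h, ← EReal.coe_ennreal_toReal h2, EReal.coe_ennreal_top, EReal.top_sub_coe] at ht'
    exact lt_irrefl _ ht'
  have hae : ∀ᵐ r ∂μ, conjβ β r (t + θ₂ * X r) = conjReal β X θ₂ t r := by
    filter_upwards [ae_lt_top (measurable_ePos.comp hm) h1] with r hr
    refine (EReal.coe_toReal (fun h => ?_) hst.conj_ne_bot).symm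
    simp [h, ePos] at hr
  refine ⟨hae, hm.ereal_toReal.aestronglyMeasurable, ?_⟩
  rw [hasFiniteIntegral_iff_norm]
  refine (lintegral_mono_ae (hae.mono fun r hr => ?_)).trans_lt
    ((lintegral_add_left (measurable_ePos.comp hm) _).trans_lt
      (ENNReal.add_lt_top.2 ⟨h1.lt_top, h2.lt_top⟩))
  rw [Function.comp_apply, hr, ← EReal.coe_neg, ePos_coe_s1, ePos_coe_s1, Real.norm_eq_abs]
  rcases abs_cases (conjReal β X θ₂ t r) with ⟨h, _⟩ | ⟨h, _⟩ <;> rw [h]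
  · exact le_self_add
  · exact le_add_self

theorem Kfun_sub_eq (hst : Standing μ β β' X p₀ b₀) (ht : (t, θ₂) ∈ domK μ β X) :
    Kfun μ β X t θ₂ - (t : EReal) = ((∫ r, conjReal β X θ₂ t r ∂μ - t : ℝ) : EReal) := by
  rw [Kfun, eInt_eq_integral (hst.domK_facts ht).1 (hst.domK_facts ht).2, ← EReal.coe_sub]

theorem mem_domK_of_le_of_mem (hst : Standing μ β β' X p₀ b₀) (ht : (t, θ₂) ∈ domK μ β X)
    (h : t' ≤ t) : (t', θ₂) ∈ domK μ β X :=
  hst.mem_domK_of_le (hst.domK_facts ht).2 ((hst.domK_facts ht).1.mono fun _ hr =>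
    hr ▸ hst.conj_mono (by linarith))

theorem ae_conjReal_le (hst : Standing μ β β' X p₀ b₀) (ht : (t, θ₂) ∈ domK μ β X)
    (h : t' ≤ t) : ∀ᵐ r ∂μ, conjReal β X θ₂ t' r ≤ conjReal β X θ₂ t r := by
  filter_upwards [(hst.domK_facts ht).1, (hst.domK_facts (hst.mem_domK_of_le_of_mem ht h)).1]
    with r h1 h2
  rw [← EReal.coe_le_coe_iff, ← h1, ← h2]
  exact hst.conj_mono (by linarith)

theorem ae_le_conjReal (hst : Standing μ β β' X p₀ b₀) (ht : (t, θ₂) ∈ domK μ β X) :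
    ∀ᵐ r ∂μ, ∀ s : ℝ, 0 < s →
      s * (t + θ₂ * X r) - (β r s).toReal ≤ conjReal β X θ₂ t r := by
  filter_upwards [(hst.domK_facts ht).1] with r hr s hs
  exact hst.le_of_conj_le hs hr.le

/-- Convexity of the integrand of `K` in its first parameter. -/
theorem ae_conjReal_convex (hst : Standing μ β β' X p₀ b₀) {u : ℝ} (hu : (u, θ₂) ∈ domK μ β X)
    (h1 : t ≤ t') (h2 : t' ≤ u) : ∀ᵐ r ∂μ, (u - t) * conjReal β X θ₂ t' r ≤
      (u - t') * conjReal β X θ₂ t r + (t' - t) * conjReal β X θ₂ u r := by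
  rcases (h1.trans h2).eq_or_lt with rfl | hlt
  · obtain rfl := le_antisymm h1 h2
    simp
  have hd : 0 < u - t := sub_pos.2 hlt
  have ht' := hst.mem_domK_of_le_of_mem hu h2
  filter_upwards [(hst.domK_facts hu).1, (hst.domK_facts ht').1,
    (hst.domK_facts (hst.mem_domK_of_le_of_mem ht' h1)).1] with r e1 e2 e3
  have := hst.conj_convex (a := (u - t') / (u - t)) (b := (t' - t) / (u - t))
    (div_nonneg (by linarith) hd.le) (div_nonneg (by linarith) hd.le)
    (by field_simp; ring) e3.le e1.le
  rw [show (u - t') / (u - t) * (t + θ₂ * X r) + (t' - t) / (u - t) * (u + θ₂ * X r)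
    = t' + θ₂ * X r by field_simp; ring, e2, EReal.coe_le_coe_iff] at this
  refine (mul_le_mul_of_nonneg_left this hd.le).trans_eq ?_
  field_simp

theorem lintegral_chord (hst : Standing μ β β' X p₀ b₀) (ht : (t, θ₂) ∈ domK μ β X)
    (h : t' ≤ t) {d : ℝ} (hd : 0 ≤ d) :
    ∫⁻ r, ENNReal.ofReal ((conjReal β X θ₂ t r - conjReal β X θ₂ t' r) / d) ∂μ =
      ENNReal.ofReal
        ((∫ r, conjReal β X θ₂ t r ∂μ - ∫ r, conjReal β X θ₂ t' r ∂μ) / d) := by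
  have hi := (hst.domK_facts ht).2
  have hi' := (hst.domK_facts (hst.mem_domK_of_le_of_mem ht h)).2
  rw [← integral_sub hi hi', ← integral_div, ofReal_integral_eq_lintegral_ofReal]
  · exact (hi.sub hi').div_const _
  · filter_upwards [hst.ae_conjReal_le ht h] with r hr
    exact div_nonneg (sub_nonneg.2 hr) hd

theorem measurable_chord (hst : Standing μ β β' X p₀ b₀) (θ₂ t t' d : ℝ) :
    Measurable fun r => ENNReal.ofReal ((conjReal β X θ₂ t r - conjReal β X θ₂ t' r) / d) := by
  have hm : ∀ t, Measurable (conjReal β X θ₂ t) := fun t =>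
    (hst.measurable_conj (measurable_const.add (hst.Xmeas.const_mul _))).ereal_toReal
  exact (((hm t).sub (hm t')).div_const _).ennreal_ofReal

end Domain

section Minimiser

variable {θ₂ t₀ : ℝ}

theorem _root_.lintegral_liminf_le_of_tendsto {f : ℕ → Ω → ℝ≥0∞} {u : ℕ → ℝ≥0∞} {l : ℝ≥0∞}
    (hf : ∀ n, Measurable (f n)) (hu : ∀ n, ∫⁻ r, f n r ∂μ ≤ u n)
    (hl : Tendsto u atTop (𝓝 l)) : ∫⁻ r, liminf (fun n => f n r) atTop ∂μ ≤ l :=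
  (lintegral_liminf_le hf).trans
    ((liminf_le_liminf (Eventually.of_forall hu)).trans hl.liminf_eq.le)

theorem _root_.ENNReal.le_liminf_of_tendsto {u v : ℕ → ℝ≥0∞} {l : ℝ≥0∞}
    (huv : ∀ᶠ n in atTop, v n ≤ u n) (hv : Tendsto v atTop (𝓝 l)) : l ≤ liminf u atTop :=
  hv.liminf_eq.symm.le.trans (liminf_le_liminf huv)

theorem _root_.ENNReal.eq_top_of_forall_ofReal_le {x : ℝ≥0∞}
    (h : ∀ s : ℝ, 0 < s → ENNReal.ofReal s ≤ x) : x = ⊤ := by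
  by_contra hx
  have := h (x.toReal + 1) (by positivity)
  rw [ENNReal.ofReal_le_iff_le_toReal hx] at this
  linarith

theorem _root_.HasDerivAt.tendsto_quotient {f : ℝ → ℝ} {f' x : ℝ} (hf : HasDerivAt f f' x)
    {e : ℕ → ℝ} (he : Tendsto e atTop (𝓝 0)) (he0 : ∀ n, e n ≠ 0) :
    Tendsto (fun n => (f (x + e n) - f x) / e n) atTop (𝓝 f') := by
  have h : Tendsto (fun n => x + e n) atTop (𝓝[≠] x) := by
    refine tendsto_nhdsWithin_iff.2 ⟨by simpa using he.const_add x, ?_⟩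
    exact Eventually.of_forall fun n => by simp [he0 n]
  refine ((hasDerivAt_iff_tendsto_slope.1 hf).comp h).congr fun n => ?_
  simp [slope_def_field]

theorem sublevel_bddBelow (hst : Standing μ β β' X p₀ b₀) (ht₀ : (t₀, θ₂) ∈ domK μ β X)
    (C : ℝ) : ∃ A, ∀ t, (t, θ₂) ∈ domK μ β X → ∫ r, conjReal β X θ₂ t r ∂μ - t ≤ C → A ≤ t := by
  by_contra! hcon
  choose T hTD hTC hT using fun n : ℕ => hcon (t₀ - (n + 1))
  have hd1 : ∀ n : ℕ, (n : ℝ) + 1 < t₀ - T n := fun n => by linarith [hT n]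
  have hd0 : ∀ n, 1 < t₀ - T n := fun n => by linarith [hd1 n, n.cast_nonneg (α := ℝ)]
  have hd : Tendsto (fun n => t₀ - T n) atTop atTop :=
    tendsto_atTop_mono (fun n => (lt_add_one (n : ℝ)).le.trans (hd1 n).le)
      tendsto_natCast_atTop_atTop
  have hi := (hst.domK_facts ht₀).2
  have hi' := fun n => (hst.domK_facts (hTD n)).2
  have hmem : (t₀ - 1, θ₂) ∈ domK μ β X := hst.mem_domK_of_le_of_mem ht₀ (by linarith)
  have hle : ∀ n, T n ≤ t₀ - 1 := fun n => by linarith [hd0 n]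
  have hlim : Tendsto (fun n => ∫ r, (conjReal β X θ₂ t₀ r - conjReal β X θ₂ (T n) r) /
      (t₀ - T n) ∂μ) atTop (𝓝 (∫ _, 0 ∂μ)) := by
    refine tendsto_integral_of_dominated_convergence
      (fun r => conjReal β X θ₂ t₀ r - conjReal β X θ₂ (t₀ - 1) r)
      (fun n => ((hi.sub (hi' n)).div_const _).aestronglyMeasurable)
      (hi.sub (hst.domK_facts hmem).2) (fun n => ?_) ?_
    · filter_upwards [hst.ae_conjReal_le ht₀ ((hle n).trans (by linarith)),
        hst.ae_conjReal_convex ht₀ (hle n) (by linarith)] with r h1 h2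
      have hpos : 0 < t₀ - T n := by linarith [hd0 n]
      rw [Real.norm_of_nonneg (div_nonneg (sub_nonneg.2 h1) hpos.le), div_le_iff₀ hpos]
      linarith
    · have hall : ∀ᵐ r ∂μ, ∀ n, conjReal β X θ₂ (T n) r ≤ conjReal β X θ₂ t₀ r ∧
          ∀ s : ℝ, 0 < s →
            s * (T n + θ₂ * X r) - (β r s).toReal ≤ conjReal β X θ₂ (T n) r := by
        refine ae_all_iff.2 fun n => ?_
        filter_upwards [hst.ae_conjReal_le ht₀ ((hle n).trans (by linarith)),
          hst.ae_le_conjReal (hTD n)] with r h1 h2 using ⟨h1, h2⟩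
      filter_upwards [hall] with r hr
      refine tendsto_order.2 ⟨fun a ha => Eventually.of_forall fun n => ?_, fun ε hε => ?_⟩
      · exact ha.trans_le (div_nonneg (sub_nonneg.2 (hr n).1) (by linarith [hd0 n]))
      · have hc : Tendsto (fun n => (conjReal β X θ₂ t₀ r - ε / 2 * (t₀ + θ₂ * X r) +
            (β r (ε / 2)).toReal) / (t₀ - T n)) atTop (𝓝 0) := tendsto_const_nhds.div_atTop hd
        filter_upwards [hc.eventually (gt_mem_nhds (half_pos hε))] with n hn
        have hpos : 0 < t₀ - T n := by linarith [hd0 n]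
        rw [div_lt_iff₀ hpos] at hn ⊢
        linarith [(hr n).2 (ε / 2) (half_pos hε)]
  have hlow : Tendsto (fun n => 1 + (∫ r, conjReal β X θ₂ t₀ r ∂μ - C - t₀) / (t₀ - T n)) atTop
      (𝓝 (1 + 0)) := tendsto_const_nhds.add (tendsto_const_nhds.div_atTop hd)
  have := le_of_tendsto_of_tendsto' hlow hlim fun n => by
    have hpos : 0 < t₀ - T n := by linarith [hd0 n]
    rw [integral_div, integral_sub hi (hi' n), le_div_iff₀ hpos, add_mul,
      div_mul_cancel₀ _ hpos.ne']
    linarith [hTC n]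
  norm_num at this

theorem sublevel_bddAbove (hst : Standing μ β β' X p₀ b₀) (ht₀ : (t₀, θ₂) ∈ domK μ β X)
    (C : ℝ) : ∃ B, ∀ t, (t, θ₂) ∈ domK μ β X → ∫ r, conjReal β X θ₂ t r ∂μ - t ≤ C → t ≤ B := by
  by_contra! hcon
  choose T hTD hTC hT using fun n : ℕ => hcon (t₀ + (n + 1))
  have hd1 : ∀ n : ℕ, (n : ℝ) + 1 < T n - t₀ := fun n => by linarith [hT n]
  have hd0 : ∀ n, 0 < T n - t₀ := fun n => by linarith [hd1 n, n.cast_nonneg (α := ℝ)]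
  have hd : Tendsto (fun n => T n - t₀) atTop atTop :=
    tendsto_atTop_mono (fun n => (lt_add_one (n : ℝ)).le.trans (hd1 n).le)
      tendsto_natCast_atTop_atTop
  have hup : Tendsto (fun n => ENNReal.ofReal
      (1 + (C + t₀ - ∫ r, conjReal β X θ₂ t₀ r ∂μ) / (T n - t₀))) atTop
      (𝓝 (ENNReal.ofReal (1 + 0))) :=
    ENNReal.tendsto_ofReal (tendsto_const_nhds.add (tendsto_const_nhds.div_atTop hd))
  have hF := lintegral_liminf_le_of_tendsto (μ := μ)
    (fun n => hst.measurable_chord θ₂ (T n) t₀ (T n - t₀)) (fun n => by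
      rw [hst.lintegral_chord (hTD n) (by linarith [hd0 n]) (hd0 n).le]
      refine ENNReal.ofReal_le_ofReal ?_
      rw [div_le_iff₀ (hd0 n), add_mul, div_mul_cancel₀ _ (hd0 n).ne']
      linarith [hTC n]) hup
  have htop : ∀ᵐ r ∂μ, liminf (fun n => ENNReal.ofReal
      ((conjReal β X θ₂ (T n) r - conjReal β X θ₂ t₀ r) / (T n - t₀))) atTop = ⊤ := by
    filter_upwards [ae_all_iff.2 fun n => hst.ae_le_conjReal (hTD n)] with r hr
    refine ENNReal.eq_top_of_forall_ofReal_le fun s hs => ?_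
    have hc : Tendsto (fun n => s + (s * (t₀ + θ₂ * X r) - (β r s).toReal -
        conjReal β X θ₂ t₀ r) / (T n - t₀)) atTop (𝓝 (s + 0)) :=
      tendsto_const_nhds.add (tendsto_const_nhds.div_atTop hd)
    rw [add_zero] at hc
    refine ENNReal.le_liminf_of_tendsto (Eventually.of_forall fun n => ?_)
      (ENNReal.tendsto_ofReal hc)
    refine ENNReal.ofReal_le_ofReal ?_
    rw [le_div_iff₀ (hd0 n), add_mul, div_mul_cancel₀ _ (hd0 n).ne']
    linarith [hr n s hs]
  have hμ : μ ≠ 0 := by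
    rintro rfl
    simpa using hst.dens₀.2.2
  rw [lintegral_congr_ae htop, lintegral_const, ENNReal.top_mul (by simpa using hμ)] at hF
  simp at hF

theorem exists_minimiser (hst : Standing μ β β' X p₀ b₀) (ht₀ : (t₀, θ₂) ∈ domK μ β X) :
    ∃ tm, (tm, θ₂) ∈ domK μ β X ∧ ∀ t, (t, θ₂) ∈ domK μ β X →
      ∫ r, conjReal β X θ₂ tm r ∂μ - tm ≤ ∫ r, conjReal β X θ₂ t r ∂μ - t := by
  set g : ℝ → ℝ := fun t => ∫ r, conjReal β X θ₂ t r ∂μ - t with hg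
  obtain ⟨A, hA⟩ := hst.sublevel_bddBelow ht₀ (g t₀)
  obtain ⟨B, hB⟩ := hst.sublevel_bddAbove ht₀ (g t₀)
  have haD : (A, θ₂) ∈ domK μ β X := hst.mem_domK_of_le_of_mem ht₀ (hA t₀ ht₀ le_rfl)
  have hia := (hst.domK_facts haD).2
  have hmono : ∀ t, (t, θ₂) ∈ domK μ β X → A ≤ t →
      ∫ r, conjReal β X θ₂ A r ∂μ ≤ ∫ r, conjReal β X θ₂ t r ∂μ := fun t ht h =>
    integral_mono_ae hia (hst.domK_facts ht).2 (hst.ae_conjReal_le ht h)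
  set S : Set ℝ := g '' {t | (t, θ₂) ∈ domK μ β X ∧ g t ≤ g t₀} with hS
  have hSne : S.Nonempty := ⟨g t₀, t₀, ⟨ht₀, le_rfl⟩, rfl⟩
  have hSb : BddBelow S := by
    refine ⟨∫ r, conjReal β X θ₂ A r ∂μ - B, ?_⟩
    rintro _ ⟨t, ⟨ht, htg⟩, rfl⟩
    exact sub_le_sub (hmono t ht (hA t ht htg)) (hB t ht htg)
  obtain ⟨u, -, hu, huS⟩ := exists_seq_tendsto_sInf hSne hSb
  choose T hT hTu using huS
  obtain ⟨tm, -, φ, hφ, htm⟩ := (isCompact_Icc (a := A) (b := B)).tendsto_subseq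
    (fun n => ⟨hA _ (hT n).1 (hT n).2, hB _ (hT n).1 (hT n).2⟩)
  have hk : Tendsto (fun n => ∫ r, conjReal β X θ₂ (T (φ n)) r ∂μ -
      ∫ r, conjReal β X θ₂ A r ∂μ) atTop
      (𝓝 (sInf S + tm - ∫ r, conjReal β X θ₂ A r ∂μ)) := by
    refine Tendsto.sub_const (((hu.comp hφ.tendsto_atTop).add htm).congr fun n => ?_) _
    simp [← hTu, hg]
  have hk0 := ge_of_tendsto' hk fun n =>
    sub_nonneg.2 (hmono _ (hT _).1 (hA _ (hT _).1 (hT _).2))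
  set L : Ω → ℝ≥0∞ := fun r => liminf (fun n => ENNReal.ofReal
    ((conjReal β X θ₂ (T (φ n)) r - conjReal β X θ₂ A r) / 1)) atTop with hL
  have hLm : Measurable L := Measurable.liminf fun n => hst.measurable_chord _ _ _ _
  have hLint : ∫⁻ r, L r ∂μ ≤ _ := lintegral_liminf_le_of_tendsto (μ := μ)
    (fun n => hst.measurable_chord θ₂ (T (φ n)) A 1) (fun n => by
      rw [hst.lintegral_chord (hT _).1 (hA _ (hT _).1 (hT _).2) zero_le_one, div_one])
    (ENNReal.tendsto_ofReal hk)
  have hLtop : ∫⁻ r, L r ∂μ ≠ ⊤ := ne_top_of_le_ne_top ENNReal.ofReal_ne_top hLint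
  have hLi : Integrable (fun r => (L r).toReal) μ :=
    integrable_toReal_of_lintegral_ne_top hLm.aemeasurable hLtop
  have hbound : ∀ᵐ r ∂μ, conjβ β r (tm + θ₂ * X r) ≤
      ((conjReal β X θ₂ A r + (L r).toReal : ℝ) : EReal) := by
    filter_upwards [ae_lt_top hLm hLtop, ae_all_iff.2 fun n => hst.ae_le_conjReal (hT n).1]
      with r h1 h2
    refine hst.conj_le fun s hs => ?_
    have hc : Tendsto (fun n => s * (T (φ n) + θ₂ * X r) - (β r s).toReal -
        conjReal β X θ₂ A r) atTop
        (𝓝 (s * (tm + θ₂ * X r) - (β r s).toReal - conjReal β X θ₂ A r)) :=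
      (((htm.add_const _).const_mul _).sub_const _).sub_const _
    have := ENNReal.le_liminf_of_tendsto (u := fun n => ENNReal.ofReal
      ((conjReal β X θ₂ (T (φ n)) r - conjReal β X θ₂ A r) / 1))
      (Eventually.of_forall fun n => ENNReal.ofReal_le_ofReal
        (by rw [div_one]; linarith [h2 (φ n) s hs])) (ENNReal.tendsto_ofReal hc)
    rw [ENNReal.ofReal_le_iff_le_toReal h1.ne] at this
    linarith
  have htmD := hst.mem_domK_of_le (hia.add hLi) hbound
  have hval : g tm ≤ sInf S := by
    have h1 : ∫ r, conjReal β X θ₂ tm r ∂μ ≤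
        ∫ r, (conjReal β X θ₂ A r + (L r).toReal) ∂μ := by
      refine integral_mono_ae (hst.domK_facts htmD).2 (hia.add hLi) ?_
      filter_upwards [hbound, (hst.domK_facts htmD).1] with r h1 h2
      rwa [h2, EReal.coe_le_coe_iff] at h1
    rw [integral_add hia hLi, integral_toReal hLm.aemeasurable (ae_lt_top hLm hLtop)] at h1
    have h2 := ENNReal.toReal_mono ENNReal.ofReal_ne_top hLint
    rw [ENNReal.toReal_ofReal hk0] at h2
    simp only [hg]
    linarith
  refine ⟨tm, htmD, fun t ht => ?_⟩
  rcases le_total (g t) (g t₀) with h | h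
  · exact hval.trans (csInf_le hSb ⟨t, ⟨ht, h⟩, rfl⟩)
  · exact hval.trans ((csInf_le hSb ⟨t₀, ⟨ht₀, le_rfl⟩, rfl⟩).trans h)

variable {tm : ℝ}

/-- Fatou's lemma for the left difference quotients at a minimiser. -/
theorem mem_ThetaSet_of_minimiser (hst : Standing μ β β' X p₀ b₀) (hψ : IsConjDeriv β β' ψ)
    (htm : (tm, θ₂) ∈ domK μ β X)
    (hmin : ∀ t, (t, θ₂) ∈ domK μ β X →
      ∫ r, conjReal β X θ₂ tm r ∂μ - tm ≤ ∫ r, conjReal β X θ₂ t r ∂μ - t) :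
    (tm, θ₂) ∈ ThetaSet μ β β' X ∧ pInt μ (pFam ψ X tm θ₂) ≤ 1 := by
  set e : ℕ → ℝ := fun n => 1 / ((n : ℝ) + 1) with he
  have he0 : ∀ n, 0 < e n := fun n => by positivity
  have hel : Tendsto e atTop (𝓝 0) := tendsto_one_div_add_atTop_nhds_zero_nat
  have hle : ∀ n, tm - e n ≤ tm := fun n => by linarith [he0 n]
  have hD : ∀ n, (tm - e n, θ₂) ∈ domK μ β X := fun n => hst.mem_domK_of_le_of_mem htm (hle n)
  set L : Ω → ℝ≥0∞ := fun r => liminf (fun n => ENNReal.ofReal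
    ((conjReal β X θ₂ tm r - conjReal β X θ₂ (tm - e n) r) / e n)) atTop with hL
  have hLm : Measurable L := Measurable.liminf fun n => hst.measurable_chord _ _ _ _
  have hLint : ∫⁻ r, L r ∂μ ≤ 1 := lintegral_liminf_le_of_tendsto (μ := μ)
    (fun n => hst.measurable_chord θ₂ tm (tm - e n) (e n)) (fun n => by
      rw [hst.lintegral_chord htm (hle n) (he0 n).le, ← ENNReal.ofReal_one]
      refine ENNReal.ofReal_le_ofReal ?_
      rw [div_le_one (he0 n)]
      linarith [hmin _ (hD n)]) tendsto_const_nhds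
  have hlt : ∀ᵐ r ∂μ, ((tm + θ₂ * X r : ℝ) : EReal) < derivTop β' r := by
    filter_upwards [ae_lt_top hLm (ne_top_of_le_ne_top ENNReal.one_ne_top hLint),
      (hst.domK_facts htm).1, ae_all_iff.2 fun n => (hst.domK_facts (hD n)).1] with r h1 h2 h3
    by_contra hnlt
    refine h1.ne (ENNReal.eq_top_of_forall_ofReal_le fun s hs => ?_)
    refine ENNReal.le_liminf_of_tendsto ?_ tendsto_const_nhds
    have hlim : Tendsto (fun n => tm - e n + θ₂ * X r) atTop (𝓝 (tm - 0 + θ₂ * X r)) :=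
      (hel.const_sub _).add_const _
    rw [sub_zero] at hlim
    filter_upwards [hlim.eventually (lt_mem_nhds (hst.deriv_lt hs hnlt))] with n hn
    have := hst.conj_le_of_deriv_le hs hn.le (by linarith [he0 n]) h2.le
    rw [h3 n, EReal.coe_le_coe_iff] at this
    refine ENNReal.ofReal_le_ofReal ?_
    rw [le_div_iff₀ (he0 n)]
    linarith
  refine ⟨⟨htm, hlt⟩, le_trans (lintegral_mono_ae ?_) hLint⟩
  filter_upwards [hlt] with r hr
  refine ENNReal.le_liminf_of_tendsto (Eventually.of_forall fun n => le_rfl)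
    (ENNReal.tendsto_ofReal ?_)
  refine ((hψ r _ hr).tendsto_quotient (by simpa using hel.neg)
    (fun n => neg_ne_zero.2 (he0 n).ne')).congr fun n => ?_
  rw [div_neg, ← neg_div, neg_sub, conjReal, conjReal]
  ring_nf

/-- Dominated convergence for the right difference quotients at a minimiser. -/
theorem one_le_pInt_of_minimiser (hst : Standing μ β β' X p₀ b₀) (hψ : IsConjDeriv β β' ψ)
    (htm : (tm, θ₂) ∈ ThetaSet μ β β' X)
    (hmin : ∀ t, (t, θ₂) ∈ domK μ β X →
      ∫ r, conjReal β X θ₂ tm r ∂μ - tm ≤ ∫ r, conjReal β X θ₂ t r ∂μ - t)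
    {t : ℝ} (ht : (t, θ₂) ∈ domK μ β X) (hlt : tm < t) : 1 ≤ pInt μ (pFam ψ X tm θ₂) := by
  have hd := sub_pos.2 hlt
  set e : ℕ → ℝ := fun n => (t - tm) * (1 / ((n : ℝ) + 1)) with he
  have he0 : ∀ n, 0 < e n := fun n => by positivity
  have hel : Tendsto e atTop (𝓝 0) := by
    have := (tendsto_one_div_add_atTop_nhds_zero_nat (𝕜 := ℝ)).const_mul (t - tm)
    rwa [mul_zero] at this
  have hle : ∀ n, tm ≤ tm + e n := fun n => by linarith [he0 n]
  have hle' : ∀ n, tm + e n ≤ t := fun n => by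
    have h1 : 1 / ((n : ℝ) + 1) ≤ 1 := by
      rw [div_le_one (by positivity)]
      linarith [n.cast_nonneg (α := ℝ)]
    linarith [mul_le_of_le_one_right hd.le h1]
  have hD : ∀ n, (tm + e n, θ₂) ∈ domK μ β X := fun n => hst.mem_domK_of_le_of_mem ht (hle' n)
  have hlim : Tendsto (fun n => ∫⁻ r, ENNReal.ofReal
      ((conjReal β X θ₂ (tm + e n) r - conjReal β X θ₂ tm r) / e n) ∂μ) atTop
      (𝓝 (pInt μ (pFam ψ X tm θ₂))) := by
    refine tendsto_lintegral_of_dominated_convergence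
      (fun r => ENNReal.ofReal ((conjReal β X θ₂ t r - conjReal β X θ₂ tm r) / (t - tm)))
      (fun n => hst.measurable_chord _ _ _ _) (fun n => ?_) ?_ ?_
    · filter_upwards [hst.ae_conjReal_convex ht (hle n) (hle' n)] with r hr
      refine ENNReal.ofReal_le_ofReal ?_
      rw [div_le_div_iff₀ (he0 n) hd]
      linarith
    · rw [hst.lintegral_chord ht hlt.le hd.le]
      exact ENNReal.ofReal_ne_top
    · filter_upwards [htm.2] with r hr
      refine ENNReal.tendsto_ofReal (((hψ r _ hr).tendsto_quotient hel
        (fun n => (he0 n).ne')).congr fun n => ?_)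
      rw [conjReal, conjReal, add_right_comm]
  refine ge_of_tendsto' hlim fun n => ?_
  rw [hst.lintegral_chord (hD n) (hle n) (he0 n).le, ← ENNReal.ofReal_one]
  refine ENNReal.ofReal_le_ofReal ?_
  rw [le_div_iff₀ (he0 n)]
  linarith [hmin _ (hD n)]

theorem minimiser_not_lt (hst : Standing μ β β' X p₀ b₀) {t : ℝ} (ht : (t, θ₂) ∈ domK μ β X)
    (hmin : ∀ s, (s, θ₂) ∈ domK μ β X →
      ∫ r, conjReal β X θ₂ tm r ∂μ - tm ≤ ∫ r, conjReal β X θ₂ s r ∂μ - s)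
    (hmin' : ∀ s, (s, θ₂) ∈ domK μ β X →
      ∫ r, conjReal β X θ₂ t r ∂μ - t ≤ ∫ r, conjReal β X θ₂ s r ∂μ - s) : ¬ tm < t := by
  intro hlt
  obtain ⟨h, hh, rfl⟩ : ∃ h : ℝ, 0 < h ∧ t = tm + 3 * h := ⟨(t - tm) / 3, by linarith, by ring⟩
  have hD0 := hst.mem_domK_of_le_of_mem (t' := tm) ht (by linarith)
  have hD1 := hst.mem_domK_of_le_of_mem (t' := tm + h) ht (by linarith)
  have hD2 := hst.mem_domK_of_le_of_mem (t' := tm + 2 * h) ht (by linarith)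
  obtain ⟨e0, i0⟩ := hst.domK_facts hD0
  obtain ⟨e1, i1⟩ := hst.domK_facts hD1
  obtain ⟨e2, i2⟩ := hst.domK_facts hD2
  obtain ⟨e3, i3⟩ := hst.domK_facts ht
  have hstrict : ∀ᵐ r ∂μ, conjReal β X θ₂ tm r < conjReal β X θ₂ (tm + h) r →
      conjReal β X θ₂ (tm + h) r - conjReal β X θ₂ tm r <
        conjReal β X θ₂ (tm + 3 * h) r - conjReal β X θ₂ (tm + 2 * h) r := by
    filter_upwards [e0, e1, e2, e3] with r e0 e1 e2 e3
    rw [add_right_comm] at e1 e2 e3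
    exact hst.chord_lt_chord hh e0 e1 e2 e3
  have hm1 := hst.ae_conjReal_le hD1 (t' := tm) (by linarith)
  have hm3 := hst.ae_conjReal_le ht (t' := tm + 2 * h) (by linarith)
  have hint1 := integral_sub i1 i0
  have hint3 := integral_sub i3 i2
  have hg1 := hmin _ hD1
  have hg3 := hmin' _ hD2
  have hle : (fun r => conjReal β X θ₂ (tm + h) r - conjReal β X θ₂ tm r) ≤ᵐ[μ]
      fun r => conjReal β X θ₂ (tm + 3 * h) r - conjReal β X θ₂ (tm + 2 * h) r := by
    filter_upwards [hstrict, hm1, hm3] with r h1 h2 h3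
    rcases h2.lt_or_eq with h2 | h2
    · exact (h1 h2).le
    · linarith
  have hge : ∫ r, (conjReal β X θ₂ (tm + 3 * h) r - conjReal β X θ₂ (tm + 2 * h) r) ∂μ ≤
      ∫ r, (conjReal β X θ₂ (tm + h) r - conjReal β X θ₂ tm r) ∂μ := by
    rw [hint1, hint3]
    linarith
  have heq := (integral_eq_iff_of_ae_le (i1.sub i0) (i3.sub i2) hle).1
    (le_antisymm (integral_mono_ae (i1.sub i0) (i3.sub i2) hle) hge)
  have hneg : ∫ r, (conjReal β X θ₂ (tm + h) r - conjReal β X θ₂ tm r) ∂μ ≤ 0 := by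
    refine integral_nonpos_of_ae ?_
    filter_upwards [heq, hstrict] with r h1 h2
    by_contra! hpos
    exact (h2 (sub_pos.1 hpos)).ne h1
  linarith

end Minimiser

end Standing

/-- Lemma on evaluating `G`. For any `θ₂ ∈ Θ₂`, the infimum defining
`G(θ₂)` is attained at a unique minimiser `θm`, and exactly one of the following holds:
(i) `(θm, θ₂) ∈ Θ` and `∫ p_{θm,θ₂} dμ = 1`; or (ii) `θm` is the (finite) supremum of
`{θ₁ : (θ₁,θ₂) ∈ dom K}`, `(θm, θ₂) ∈ Θ`, and `∫ p_{θm,θ₂} dμ < 1`. -/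
theorem lemma_G_attained {Ω : Type*} [MeasurableSpace Ω] (μ : Measure Ω)
    (β : Ω → ℝ → EReal) (β' : Ω → ℝ → ℝ) (ψ : Ω → ℝ → ℝ) (X : Ω → ℝ) (p₀ : Ω → ℝ) (b₀ : ℝ)
    (hst : Standing μ β β' X p₀ b₀) (hψ : IsConjDeriv β β' ψ)
    (θ₂ : ℝ) (hθ₂ : θ₂ ∈ Theta2 μ β X) :
    ∃ θm : ℝ,
      Kfun μ β X θm θ₂ - (θm : EReal) = Gfun μ β X θ₂ ∧
      (∀ θ₁ : ℝ, Kfun μ β X θ₁ θ₂ - (θ₁ : EReal) = Gfun μ β X θ₂ → θ₁ = θm) ∧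
      Xor'
        ((θm, θ₂) ∈ ThetaSet μ β β' X ∧ pInt μ (pFam ψ X θm θ₂) = 1)
        (IsLUB {θ₁ : ℝ | (θ₁, θ₂) ∈ domK μ β X} θm ∧ (θm, θ₂) ∈ ThetaSet μ β β' X ∧
          pInt μ (pFam ψ X θm θ₂) < 1) := by
  obtain ⟨t₀, ht₀⟩ : ∃ t₀, (t₀, θ₂) ∈ domK μ β X := by
    have hfin : ⨅ t : ℝ, (Kfun μ β X t θ₂ - (t : EReal)) < ⊤ := hθ₂
    obtain ⟨t₀, h⟩ := iInf_lt_iff.1 hfin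
    refine ⟨t₀, by_contra fun hnot => ?_⟩
    have hK : Kfun μ β X t₀ θ₂ = ⊤ := not_lt_top_iff.1 hnot
    rw [hK, EReal.top_sub_coe] at h
    exact lt_irrefl _ h
  obtain ⟨tm, htm, hmin⟩ := hst.exists_minimiser ht₀
  have hG : Gfun μ β X θ₂ = Kfun μ β X tm θ₂ - (tm : EReal) := by
    refine le_antisymm (iInf_le _ tm) (le_iInf fun t => ?_)
    by_cases ht : (t, θ₂) ∈ domK μ β X
    · rw [hst.Kfun_sub_eq ht, hst.Kfun_sub_eq htm, EReal.coe_le_coe_iff]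
      exact hmin t ht
    · have hK : Kfun μ β X t θ₂ = ⊤ := not_lt_top_iff.1 ht
      rw [hK, EReal.top_sub_coe]
      exact le_top
  obtain ⟨hΘ, hle⟩ := hst.mem_ThetaSet_of_minimiser hψ htm hmin
  refine ⟨tm, hG.symm, fun t ht => ?_, ?_⟩
  · have htD : (t, θ₂) ∈ domK μ β X := by
      by_contra hnot
      have hK : Kfun μ β X t θ₂ = ⊤ := not_lt_top_iff.1 hnot
      rw [hK, EReal.top_sub_coe] at ht
      exact hθ₂.ne ht.symm
    rw [hG, hst.Kfun_sub_eq htD, hst.Kfun_sub_eq htm, EReal.coe_eq_coe_iff] at ht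
    have hmin' := ht.symm ▸ hmin
    exact le_antisymm (not_lt.1 (hst.minimiser_not_lt htD hmin hmin'))
      (not_lt.1 (hst.minimiser_not_lt htm hmin' hmin))
  · rcases hle.eq_or_lt with h1 | h1
    · exact Or.inl ⟨⟨hΘ, h1⟩, fun h => h.2.2.ne h1⟩
    · refine Or.inr ⟨⟨⟨fun t ht => ?_, fun b hb => hb htm⟩, hΘ, h1⟩, fun h => h1.ne h.2⟩
      by_contra! hlt
      exact h1.not_ge (hst.one_le_pInt_of_minimiser hψ hΘ hmin ht hlt)
end
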